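/- arXiv:2110.01197 — 2 statements merged into one kernel-verified Lean document; each statement's English description precedes it below -/
import Mathlib

section
/- Let n ≥ 1 and let p⃗ be an n-tuple with 1 < pᵢ < ∞. There exist positive constants C₁ ≤ C₂ such that for all b ∈ BMO(ℝⁿ): C₁·‖b‖_{BMO} ≤ sup_{B ⊂ ℝⁿ} ‖(b − b_B)·χ_B‖_{L^{p⃗}} / ‖χ_B‖_{L^{p⃗}} ≤ C₂·‖b‖_{BMO}, the supremum being taken over all balls B in ℝⁿ. -/
open MeasureTheory ENNReal Filter Topology Set

noncomputable section

namespace MixedAmalgam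

/-- `L^p` norm over `ℝ` of an `ℝ≥0∞`-valued function, with the usual
modification (`essSup`) for `p = ∞`. -/
def lpInt (p : ℝ≥0∞) (g : ℝ → ℝ≥0∞) : ℝ≥0∞ :=
  if p = ∞ then essSup g volume else (∫⁻ t, g t ^ p.toReal) ^ (1 / p.toReal)

/-- `ℓ^p` norm over `ℤ` of an `ℝ≥0∞`-valued family, with the usual
modification for `p = ∞`. -/
def lpSum (p : ℝ≥0∞) (g : ℤ → ℝ≥0∞) : ℝ≥0∞ :=
  if p = ∞ then ⨆ k, g k else (∑' k, g k ^ p.toReal) ^ (1 / p.toReal)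

/-- Iterated mixed Lebesgue norm of an `ℝ≥0∞`-valued function on `ℝⁿ`,
taking the `L^{p₁}` norm in the first variable innermost, and the `L^{pₙ}`
norm in the last variable outermost. -/
def mixedE : (n : ℕ) → (Fin n → ℝ≥0∞) → ((Fin n → ℝ) → ℝ≥0∞) → ℝ≥0∞
  | 0, _, g => g Fin.elim0
  | n + 1, p, g =>
    lpInt (p (Fin.last n)) fun t =>
      mixedE n (fun i => p i.castSucc) fun x => g (Fin.snoc x t)

/-- Mixed-norm Lebesgue norm `‖f‖_{L^{p⃗}}` of a real-valued function on `ℝⁿ`. -/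
def mixedLp (n : ℕ) (p : Fin n → ℝ≥0∞) (f : (Fin n → ℝ) → ℝ) : ℝ≥0∞ :=
  mixedE n p fun x => (‖f x‖₊ : ℝ≥0∞)

/-- Iterated mixed `ℓ^{s⃗}` norm of an `ℝ≥0∞`-valued family indexed by `ℤⁿ`. -/
def mixedSeq : (n : ℕ) → (Fin n → ℝ≥0∞) → ((Fin n → ℤ) → ℝ≥0∞) → ℝ≥0∞
  | 0, _, a => a Fin.elim0
  | n + 1, s, a =>
    lpSum (s (Fin.last n)) fun k =>
      mixedSeq n (fun i => s i.castSucc) fun m => a (Fin.snoc m k)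

/-- Open Euclidean ball of center `y` and radius `r` in `ℝⁿ`. -/
def eball (n : ℕ) (y : Fin n → ℝ) (r : ℝ) : Set (Fin n → ℝ) :=
  {x | Real.sqrt (∑ i, (x i - y i) ^ 2) < r}

/-- `Σᵢ 1/pᵢ` as a real number. -/
def invSum (n : ℕ) (p : Fin n → ℝ≥0∞) : ℝ :=
  ∑ i, (1 / p i).toReal

/-- The `(L^{p⃗},L^{s⃗})` amalgam norm computed with balls of radius `r`. -/
def amalgamNormR (n : ℕ) (p s : Fin n → ℝ≥0∞) (r : ℝ) (f : (Fin n → ℝ) → ℝ) : ℝ≥0∞ :=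
  mixedE n s fun y => mixedLp n p ((eball n y r).indicator f)

/-- The amalgam norm `‖f‖_{(L^{p⃗},L^{s⃗})}`. -/
def amalgamNorm (n : ℕ) (p s : Fin n → ℝ≥0∞) (f : (Fin n → ℝ) → ℝ) : ℝ≥0∞ :=
  amalgamNormR n p s 1 f

/-- The amalgam norm `‖f‖_{(L^{p⃗},L^{s⃗})^α}`. -/
def amalgamNormA (n : ℕ) (p s : Fin n → ℝ≥0∞) (α : ℝ≥0∞) (f : (Fin n → ℝ) → ℝ) : ℝ≥0∞ :=
  ⨆ (r : ℝ) (_ : 0 < r),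
    mixedE n s fun y =>
      volume (eball n y r) ^
          ((1 / α).toReal - invSum n p / (n : ℝ) - invSum n s / (n : ℝ)) *
        mixedLp n p ((eball n y r).indicator f)

/-- The amalgam norm `‖·‖_{(L^{p⃗},L^{s⃗})^α}` for `ℝ≥0∞`-valued functions. -/
def amalgamNormAE (n : ℕ) (p s : Fin n → ℝ≥0∞) (α : ℝ≥0∞)
    (g : (Fin n → ℝ) → ℝ≥0∞) : ℝ≥0∞ :=
  ⨆ (r : ℝ) (_ : 0 < r),
    mixedE n s fun y =>
      volume (eball n y r) ^
          ((1 / α).toReal - invSum n p / (n : ℝ) - invSum n s / (n : ℝ)) *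
        mixedE n p ((eball n y r).indicator g)

/-- The cube `Q_{r,k} = r(k + [0,1)ⁿ)`. -/
def qcube (n : ℕ) (r : ℝ) (k : Fin n → ℤ) : Set (Fin n → ℝ) :=
  {x | ∀ i, r * (k i : ℝ) ≤ x i ∧ x i < r * ((k i : ℝ) + 1)}

/-- The discrete amalgam norm `_r‖f‖_{p⃗,s⃗}`. -/
def discNormR (n : ℕ) (p s : Fin n → ℝ≥0∞) (r : ℝ) (f : (Fin n → ℝ) → ℝ) : ℝ≥0∞ :=
  mixedSeq n s fun k => mixedLp n p ((qcube n r k).indicator f)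

/-- The discrete amalgam norm `‖f‖_{p⃗,s⃗} = _1‖f‖_{p⃗,s⃗}`. -/
def discNorm (n : ℕ) (p s : Fin n → ℝ≥0∞) (f : (Fin n → ℝ) → ℝ) : ℝ≥0∞ :=
  discNormR n p s 1 f

/-- The discrete amalgam norm
`‖f‖_{p⃗,s⃗,α} = sup_{r>0} r^{n/α - Σᵢ 1/pᵢ} · _r‖f‖_{p⃗,s⃗}`. -/
def discNormA (n : ℕ) (p s : Fin n → ℝ≥0∞) (α : ℝ≥0∞) (f : (Fin n → ℝ) → ℝ) : ℝ≥0∞ :=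
  ⨆ (r : ℝ) (_ : 0 < r),
    ENNReal.ofReal (r ^ ((n : ℝ) * (1 / α).toReal - invSum n p)) * discNormR n p s r f

/-- Membership in `(L^{p⃗},L^{s⃗})^α(ℝⁿ)` (continuous form). -/
def memA (n : ℕ) (p s : Fin n → ℝ≥0∞) (α : ℝ≥0∞) (f : (Fin n → ℝ) → ℝ) : Prop :=
  LocallyIntegrable f volume ∧ amalgamNormA n p s α f < ∞

/-- Membership in `(L^{p⃗},ℓ^{s⃗})(ℝⁿ)`. -/
def memD (n : ℕ) (p s : Fin n → ℝ≥0∞) (f : (Fin n → ℝ) → ℝ) : Prop :=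
  LocallyIntegrable f volume ∧ discNorm n p s f < ∞

/-- Membership in `(L^{p⃗},ℓ^{s⃗})^α(ℝⁿ)`. -/
def memDA (n : ℕ) (p s : Fin n → ℝ≥0∞) (α : ℝ≥0∞) (f : (Fin n → ℝ) → ℝ) : Prop :=
  LocallyIntegrable f volume ∧ discNormA n p s α f < ∞

/-- The dilation `St_r^{(α)} f = r^{-n/α} f(r⁻¹ ·)`. -/
def dil (n : ℕ) (α : ℝ≥0∞) (r : ℝ) (f : (Fin n → ℝ) → ℝ) : (Fin n → ℝ) → ℝ :=
  fun x => r ^ (-((n : ℝ) * (1 / α).toReal)) * f (r⁻¹ • x)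

/-- A block decomposition `f = Σ_j c_j St_{r_j}^{(α')} f_j` converging in `L¹_loc`. -/
structure BlockDecomp (n : ℕ) (p' s' : Fin n → ℝ≥0∞) (α' : ℝ≥0∞) (f : (Fin n → ℝ) → ℝ)
    (c : ℕ → ℝ) (rr : ℕ → ℝ) (g : ℕ → (Fin n → ℝ) → ℝ) : Prop where
  csummable : Summable fun j => |c j|
  rpos : ∀ j, 0 < rr j
  gloc : ∀ j, LocallyIntegrable (g j) volume
  gnorm : ∀ j, discNorm n p' s' (g j) ≤ 1
  conv : ∀ K : Set (Fin n → ℝ), IsCompact K →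
    Tendsto (fun J : ℕ =>
        ∫⁻ x in K,
          (‖f x - ∑ j ∈ Finset.range J, c j * dil n α' (rr j) (g j) x‖₊ : ℝ≥0∞))
      atTop (𝓝 0)

/-- Membership in the block space `H(p⃗',s⃗',α')`. -/
def memH (n : ℕ) (p' s' : Fin n → ℝ≥0∞) (α' : ℝ≥0∞) (f : (Fin n → ℝ) → ℝ) : Prop :=
  LocallyIntegrable f volume ∧ ∃ c rr g, BlockDecomp n p' s' α' f c rr g

/-- The norm of the block space `H(p⃗',s⃗',α')`. -/
def hNorm (n : ℕ) (p' s' : Fin n → ℝ≥0∞) (α' : ℝ≥0∞) (f : (Fin n → ℝ) → ℝ) : ℝ≥0∞ :=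
  ⨅ (c : ℕ → ℝ) (rr : ℕ → ℝ) (g : ℕ → (Fin n → ℝ) → ℝ)
    (_ : BlockDecomp n p' s' α' f c rr g), ENNReal.ofReal (∑' j, |c j|)

/-- The fractional integral operator `I_γ`. -/
def fracInt (n : ℕ) (γ : ℝ) (f : (Fin n → ℝ) → ℝ) : (Fin n → ℝ) → ℝ :=
  fun x => ∫ y, f y / Real.sqrt (∑ i, (x i - y i) ^ 2) ^ ((n : ℝ) - γ)

/-- The fractional maximal operator `M_γ`. -/
def fracMax (n : ℕ) (γ : ℝ) (f : (Fin n → ℝ) → ℝ) : (Fin n → ℝ) → ℝ≥0∞ :=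
  fun x => ⨆ (y : Fin n → ℝ) (r : ℝ) (_ : 0 < r) (_ : x ∈ eball n y r),
    volume (eball n y r) ^ (γ / (n : ℝ) - 1) * ∫⁻ z in eball n y r, (‖f z‖₊ : ℝ≥0∞)

/-- The commutator `[b, I_γ] f`. -/
def commFracInt (n : ℕ) (γ : ℝ) (b f : (Fin n → ℝ) → ℝ) : (Fin n → ℝ) → ℝ :=
  fun x => ∫ y, (b x - b y) * f y / Real.sqrt (∑ i, (x i - y i) ^ 2) ^ ((n : ℝ) - γ)

/-- The mean value `b_B` of `b` over the ball `B(y,r)`. -/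
def ballAvg (n : ℕ) (b : (Fin n → ℝ) → ℝ) (y : Fin n → ℝ) (r : ℝ) : ℝ :=
  (volume (eball n y r)).toReal⁻¹ * ∫ x in eball n y r, b x

/-- The `BMO` norm `sup_B (1/|B|) ∫_B |b - b_B|`. -/
def bmoNorm (n : ℕ) (b : (Fin n → ℝ) → ℝ) : ℝ≥0∞ :=
  ⨆ (y : Fin n → ℝ) (r : ℝ) (_ : 0 < r),
    ENNReal.ofReal
      ((volume (eball n y r)).toReal⁻¹ * ∫ x in eball n y r, |b x - ballAvg n b y r|)

set_option linter.unusedVariables false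

lemma lpInt_fin {p : ℝ≥0∞} (hp : p ≠ ∞) (g : ℝ → ℝ≥0∞) :
    lpInt p g = (∫⁻ t, g t ^ p.toReal) ^ (1 / p.toReal) := by
  simp [lpInt, hp]

lemma lpInt_mono {p : ℝ≥0∞} (hp : p ≠ ∞) {f g : ℝ → ℝ≥0∞} (h : ∀ t, f t ≤ g t) :
    lpInt p f ≤ lpInt p g := by
  rw [lpInt_fin hp, lpInt_fin hp]
  have := ENNReal.toReal_nonneg (a := p)
  gcongr with t
  exact h t

lemma lpInt_const_mul {p : ℝ≥0∞} (hp0 : p ≠ 0) (hp : p ≠ ∞) {c : ℝ≥0∞} (hc : c ≠ ∞)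
    (g : ℝ → ℝ≥0∞) :
    lpInt p (fun t => c * g t) = c * lpInt p g := by
  have hpos : 0 < p.toReal := ENNReal.toReal_pos hp0 hp
  rw [lpInt_fin hp, lpInt_fin hp]
  simp_rw [ENNReal.mul_rpow_of_nonneg _ _ hpos.le]
  rw [lintegral_const_mul' _ _ (ENNReal.rpow_ne_top_of_nonneg hpos.le hc),
    ENNReal.mul_rpow_of_nonneg _ _ (by positivity), ← ENNReal.rpow_mul,
    mul_one_div_cancel hpos.ne', ENNReal.rpow_one]

lemma lpInt_indicator {p : ℝ≥0∞} (hp0 : p ≠ 0) (hp : p ≠ ∞) {I : Set ℝ} (hI : MeasurableSet I) :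
    lpInt p (I.indicator fun _ => 1) = volume I ^ (1 / p.toReal) := by
  have hpos : 0 < p.toReal := ENNReal.toReal_pos hp0 hp
  rw [lpInt_fin hp]
  congr 1
  rw [← lintegral_indicator_one hI]
  congr 1; ext t
  by_cases ht : t ∈ I <;> simp [ht, hpos]

lemma lpInt_holder {q s : ℝ≥0∞} (hq0 : q ≠ 0) (hqs : q ≤ s) (hs : s ≠ ∞) {I : Set ℝ}
    (hI : MeasurableSet I) (hIf : volume I ≠ ∞) {g : ℝ → ℝ≥0∞} (hg : Measurable g)
    (hs0 : ∀ t, t ∉ I → g t = 0) :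
    lpInt q g * volume I ^ (1 / s.toReal) ≤ volume I ^ (1 / q.toReal) * lpInt s g := by
  have hq : q ≠ ∞ := ne_top_of_le_ne_top hs hqs
  have hqp : 0 < q.toReal := ENNReal.toReal_pos hq0 hq
  have hqs' : q.toReal ≤ s.toReal := ENNReal.toReal_mono hs hqs
  have hsp : 0 < s.toReal := hqp.trans_le hqs'
  have key : ∀ u : ℝ≥0∞, u ≠ 0 → u ≠ ∞ → lpInt u g = eLpNorm' g u.toReal (volume.restrict I) := by
    intro u hu0 hu
    have hup : 0 < u.toReal := ENNReal.toReal_pos hu0 hu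
    rw [lpInt_fin hu, eLpNorm'_eq_lintegral_enorm, ← lintegral_indicator hI]
    congr 2; ext t
    by_cases ht : t ∈ I
    · simp [ht]
    · simp [ht, hs0 t ht, hup]
  have h := eLpNorm'_le_eLpNorm'_mul_rpow_measure_univ (f := g) (μ := volume.restrict I) hqp hqs'
    hg.aestronglyMeasurable
  rw [key q hq0 hq, key s (ne_bot_of_le_ne_bot hq0 hqs) hs]
  rw [Measure.restrict_apply_univ] at h
  calc _ ≤ _ := mul_le_mul_left h _
    _ = eLpNorm' g s.toReal (volume.restrict I) *
      (volume I ^ (1 / q.toReal - 1 / s.toReal) * volume I ^ (1 / s.toReal)) := by ring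
    _ ≤ _ := by
      rw [mul_comm]
      gcongr
      rw [← ENNReal.rpow_add_of_nonneg]
      · simp
      · rw [sub_nonneg]; gcongr
      · positivity

lemma mixedE_mono : ∀ (n : ℕ) (p : Fin n → ℝ≥0∞) (_ : ∀ i, p i ≠ ∞)
    {f g : (Fin n → ℝ) → ℝ≥0∞} (_ : ∀ x, f x ≤ g x), mixedE n p f ≤ mixedE n p g
  | 0, _, _, _, _, h => h _
  | n + 1, p, hp, _, _, h =>
    lpInt_mono (hp _) fun t => mixedE_mono n _ (fun i => hp _) fun x => h _

lemma mixedE_zero : ∀ (n : ℕ) (p : Fin n → ℝ≥0∞) (_ : ∀ i, p i ≠ 0) (_ : ∀ i, p i ≠ ∞),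
    mixedE n p (fun _ => 0) = 0
  | 0, _, _, _ => rfl
  | n + 1, p, h0, hp => by
    simp only [mixedE]
    simp_rw [mixedE_zero n (fun i => p i.castSucc) (fun i => h0 _) (fun i => hp _)]
    have hpos : 0 < (p (Fin.last n)).toReal := ENNReal.toReal_pos (h0 _) (hp _)
    rw [lpInt_fin (hp _)]
    simp [hpos]

lemma measurable_snoc (n : ℕ) :
    Measurable (fun z : ℝ × (Fin n → ℝ) => (Fin.snoc z.2 z.1 : Fin (n + 1) → ℝ)) := by
  rw [measurable_pi_iff]
  intro i
  refine Fin.lastCases ?_ (fun j => ?_) i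
  · simpa using measurable_fst
  · simp only [Fin.snoc_castSucc]
    fun_prop

lemma measurable_mixedE {α : Type} [MeasurableSpace α] : ∀ (n : ℕ) (p : Fin n → ℝ≥0∞)
    (_ : ∀ i, p i ≠ ∞) {g : α × (Fin n → ℝ) → ℝ≥0∞} (_ : Measurable g),
    Measurable (fun a => mixedE n p fun x => g (a, x))
  | 0, _, _, g, hg => by
    simp only [mixedE]
    exact hg.comp (measurable_id.prodMk measurable_const)
  | n + 1, p, hp, g, hg => by
    simp only [mixedE]
    simp_rw [lpInt_fin (hp _)]
    refine Measurable.pow_const ?_ _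
    refine Measurable.lintegral_prod_right' (f := fun z : α × ℝ =>
      (mixedE n (fun i => p i.castSucc) fun x => g (z.1, Fin.snoc x z.2)) ^ _) ?_
    refine Measurable.pow_const ?_ _
    have := @measurable_mixedE (α × ℝ) _ n (fun i => p i.castSucc) (fun i => hp _)
      (fun w => g (w.1.1, Fin.snoc w.2 w.1.2)) ?_
    · exact this
    · refine hg.comp ?_
      refine Measurable.prodMk (by fun_prop) ?_
      exact (measurable_snoc n).comp (f := fun w : (α × ℝ) × (Fin n → ℝ) => (w.1.2, w.2))
        (by fun_prop)

lemma mp_snoc (n : ℕ) : MeasurePreserving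
    (fun z : ℝ × (Fin n → ℝ) => (Fin.snoc z.2 z.1 : Fin (n + 1) → ℝ))
    (volume.prod volume) volume := by
  have h := (volume_preserving_piFinSuccAbove (fun _ : Fin (n + 1) => ℝ) (Fin.last n)).symm
  have e : (fun z : ℝ × (Fin n → ℝ) => (Fin.snoc z.2 z.1 : Fin (n + 1) → ℝ)) =
      (MeasurableEquiv.piFinSuccAbove (fun _ : Fin (n + 1) => ℝ) (Fin.last n)).symm := by
    funext z
    exact (Fin.insertNth_last' z.1 z.2).symm
  rw [e]
  exact h

lemma mixedE_congr_ae : ∀ (n : ℕ) (p : Fin n → ℝ≥0∞) (_ : ∀ i, p i ≠ ∞)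
    {f g : (Fin n → ℝ) → ℝ≥0∞} (_ : f =ᵐ[volume] g), mixedE n p f = mixedE n p g
  | 0, _, _, f, g, h => by
    have : f Fin.elim0 = g Fin.elim0 := by
      by_contra hne
      have h1 : volume {x | ¬ f x = g x} = 0 := h
      have h2 : {x | ¬ f x = g x} = univ := by
        ext x; simp [Subsingleton.elim x Fin.elim0, hne]
      rw [h2, volume_pi, Measure.pi_univ] at h1
      simp at h1
    exact this
  | n + 1, p, hp, f, g, h => by
    simp only [mixedE]
    rw [lpInt_fin (hp _), lpInt_fin (hp _)]
    congr 1
    apply lintegral_congr_ae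
    have h1 := (mp_snoc n).quasiMeasurePreserving.ae h
    have h2 := Measure.ae_ae_of_ae_prod h1
    filter_upwards [h2] with t ht
    congr 1
    exact mixedE_congr_ae n _ (fun i => hp _) ht

lemma mixedE_const (P : ℝ≥0∞) (hP0 : P ≠ 0) (hP : P ≠ ∞) :
    ∀ (n : ℕ) {g : (Fin n → ℝ) → ℝ≥0∞} (_ : Measurable g),
    mixedE n (fun _ => P) g = (∫⁻ x, g x ^ P.toReal) ^ (1 / P.toReal)
  | 0, g, hg => by
    have hpos : 0 < P.toReal := ENNReal.toReal_pos hP0 hP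
    simp only [mixedE]
    rw [lintegral_unique, volume_pi, Measure.pi_univ]
    simp only [Finset.univ_eq_empty, Finset.prod_empty, mul_one]
    rw [← ENNReal.rpow_mul, mul_one_div_cancel hpos.ne', ENNReal.rpow_one]
    congr 1
  | n + 1, g, hg => by
    have hpos : 0 < P.toReal := ENNReal.toReal_pos hP0 hP
    simp only [mixedE]
    rw [lpInt_fin hP]
    congr 1
    rw [← (mp_snoc n).lintegral_comp (hg.pow_const _), lintegral_prod
      (fun z : ℝ × (Fin n → ℝ) => g (Fin.snoc z.2 z.1) ^ P.toReal)
      ((hg.comp (measurable_snoc n)).pow_const _).aemeasurable]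
    congr 1; ext t
    rw [mixedE_const P hP0 hP n (g := fun x => g (Fin.snoc x t))
      (hg.comp ((measurable_snoc n).comp measurable_prodMk_left)), ← ENNReal.rpow_mul,
      one_div_mul_cancel hpos.ne', ENNReal.rpow_one]

/-- the norm of a box -/
def boxN (n : ℕ) (p : Fin n → ℝ≥0∞) (L : ℝ≥0∞) : ℝ≥0∞ := ∏ i, L ^ (1 / (p i).toReal)

lemma boxN_ne_top (n : ℕ) (p : Fin n → ℝ≥0∞) {L : ℝ≥0∞} (hL : L ≠ ∞) : boxN n p L ≠ ∞ :=
  ENNReal.prod_ne_top fun i _ => ENNReal.rpow_ne_top_of_nonneg (by positivity) hL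

lemma boxN_ne_zero (n : ℕ) (p : Fin n → ℝ≥0∞) {L : ℝ≥0∞} (hL : L ≠ 0) (hL' : L ≠ ∞) :
    boxN n p L ≠ 0 := by
  refine Finset.prod_ne_zero_iff.2 fun i _ => ?_
  exact (ENNReal.rpow_pos (pos_iff_ne_zero.2 hL) hL').ne'

lemma mixedE_holder {L : ℝ≥0∞} (hL : L ≠ ∞) : ∀ (n : ℕ) (q s : Fin n → ℝ≥0∞)
    (_ : ∀ i, q i ≠ 0) (_ : ∀ i, q i ≤ s i) (_ : ∀ i, s i ≠ ∞) (I : Fin n → Set ℝ)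
    (_ : ∀ i, MeasurableSet (I i)) (_ : ∀ i, volume (I i) = L)
    {g : (Fin n → ℝ) → ℝ≥0∞} (_ : Measurable g) (_ : ∀ x i, x i ∉ I i → g x = 0),
    mixedE n q g * boxN n s L ≤ boxN n q L * mixedE n s g
  | 0, _, _, _, _, _, _, _, _, g, _, _ => by simp [mixedE, boxN]
  | n + 1, q, s, hq, hqs, hs, I, hI, hIL, g, hg, hgI => by
    have hs0 : ∀ i, s i ≠ 0 := fun i => ne_bot_of_le_ne_bot (hq i) (hqs i)
    have hq' : ∀ i, q i ≠ ∞ := fun i => ne_top_of_le_ne_top (hs i) (hqs i)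
    have hgt : ∀ t, Measurable fun x : Fin n → ℝ => g (Fin.snoc x t) := fun t =>
      hg.comp ((measurable_snoc n).comp measurable_prodMk_left)
    set q1 : Fin n → ℝ≥0∞ := fun i => q i.castSucc with hq1
    set s1 : Fin n → ℝ≥0∞ := fun i => s i.castSucc with hs1
    have ih : ∀ t, boxN n s1 L * mixedE n q1 (fun x => g (Fin.snoc x t)) ≤
        boxN n q1 L * mixedE n s1 (fun x => g (Fin.snoc x t)) := by
      intro t
      rw [mul_comm]
      refine mixedE_holder hL n q1 s1 (fun i => hq _) (fun i => hqs _) (fun i => hs _)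
        (fun i => I i.castSucc) (fun i => hI _) (fun i => hIL _) (hgt t) ?_
      intro x i hx
      exact hgI _ i.castSucc (by simpa using hx)
    have hmeas : Measurable fun t : ℝ => mixedE n s1 (fun x => g (Fin.snoc x t)) :=
      measurable_mixedE n s1 (fun i => hs _) (g := fun z : ℝ × (Fin n → ℝ) => g (Fin.snoc z.2 z.1))
        (hg.comp (measurable_snoc n))
    have hh := lpInt_holder (hq (Fin.last n)) (hqs (Fin.last n)) (hs _) (hI (Fin.last n))
      (by rw [hIL]; exact hL) hmeas (by
        intro t ht
        have : (fun x : Fin n → ℝ => g (Fin.snoc x t)) = fun _ => 0 := by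
          ext x
          exact hgI _ (Fin.last n) (by simpa using ht)
        rw [this]
        exact mixedE_zero _ _ (fun i => hs0 _) (fun i => hs _))
    rw [hIL] at hh
    have h1 := lpInt_mono (hq' (Fin.last n)) ih
    rw [lpInt_const_mul (hq _) (hq' _) (boxN_ne_top _ _ hL),
      lpInt_const_mul (hq _) (hq' _) (boxN_ne_top _ _ hL)] at h1
    have e : ∀ u : Fin (n + 1) → ℝ≥0∞, boxN (n + 1) u L =
      boxN n (fun i => u i.castSucc) L * L ^ (1 / (u (Fin.last n)).toReal) := fun u => by
      simp [boxN, Fin.prod_univ_castSucc]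
    rw [e q, e s]
    simp only [mixedE]
    calc _ = (boxN n s1 L * lpInt (q (Fin.last n)) fun t => mixedE n q1 fun x => g (Fin.snoc x t))
          * L ^ (1 / (s (Fin.last n)).toReal) := by ring
      _ ≤ _ := mul_le_mul_left h1 _
      _ = boxN n q1 L * ((lpInt (q (Fin.last n)) fun t => mixedE n s1 fun x => g (Fin.snoc x t))
          * L ^ (1 / (s (Fin.last n)).toReal)) := by ring
      _ ≤ _ := mul_le_mul_right hh _
      _ = _ := by ring

lemma mixedE_prod : ∀ (n : ℕ) (p : Fin n → ℝ≥0∞)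
    (_ : ∀ i, p i ≠ 0) (_ : ∀ i, p i ≠ ∞) (h : Fin n → ℝ → ℝ≥0∞)
    (_ : ∀ i, lpInt (p i) (h i) ≠ ∞) (c : ℝ≥0∞) (_ : c ≠ ∞) (_ : ∀ i t, h i t ≠ ∞),
    mixedE n p (fun x => c * ∏ i, h i (x i)) = c * ∏ i, lpInt (p i) (h i)
  | 0, _, _, _, _, _, _, _, _ => by simp [mixedE]
  | n + 1, p, h0, hp, h, hl, c, hc, hh => by
    simp only [mixedE, Fin.prod_univ_castSucc, Fin.snoc_castSucc, Fin.snoc_last]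
    have : ∀ t, (mixedE n (fun i => p i.castSucc) fun x =>
        c * ((∏ i : Fin n, h i.castSucc (x i)) * h (Fin.last n) t)) =
        (c * ∏ i : Fin n, lpInt (p i.castSucc) (h i.castSucc)) * h (Fin.last n) t := by
      intro t
      have := mixedE_prod n (fun i => p i.castSucc) (fun i => h0 _) (fun i => hp _)
        (fun i => h i.castSucc) (fun i => hl _) (c * h (Fin.last n) t)
        (ENNReal.mul_ne_top hc (hh _ _)) (fun i => hh _)
      rw [mul_right_comm] at this
      rw [← this]
      congr 1; ext x; ring
    simp_rw [this]
    rw [lpInt_const_mul (h0 _) (hp _), mul_assoc]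
    exact ENNReal.mul_ne_top hc (ENNReal.prod_ne_top fun i _ => hl _)

lemma mixedE_cube (n : ℕ) (p : Fin n → ℝ≥0∞)
    (h0 : ∀ i, p i ≠ 0) (hp : ∀ i, p i ≠ ∞) (y : Fin n → ℝ) {r : ℝ} (hr : 0 ≤ r) :
    mixedE n p ((Metric.closedBall y r).indicator fun _ => 1) = boxN n p (ENNReal.ofReal (2 * r)) := by
  have hv : ∀ i, volume (Metric.closedBall (y i) r) = ENNReal.ofReal (2 * r) := fun i => by
    rw [Real.volume_closedBall]
  have hl : ∀ i, lpInt (p i) ((Metric.closedBall (y i) r).indicator fun _ => 1) =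
      ENNReal.ofReal (2 * r) ^ (1 / (p i).toReal) := fun i => by
    rw [lpInt_indicator (h0 i) (hp i) measurableSet_closedBall, hv]
  have := mixedE_prod n p h0 hp (fun i => (Metric.closedBall (y i) r).indicator fun _ => 1)
    (fun i => by rw [hl]; exact ENNReal.rpow_ne_top_of_nonneg (by positivity) ENNReal.ofReal_ne_top)
    1 (by simp) (fun i t => by
      by_cases ht : t ∈ Metric.closedBall (y i) r <;> simp [ht])
  simp_rw [hl] at this
  rw [one_mul] at this
  rw [boxN, ← this]
  congr 1; ext x
  rw [one_mul]
  by_cases hx : x ∈ Metric.closedBall y r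
  · have hx' : ∀ i, x i ∈ Metric.closedBall (y i) r := by
      rw [closedBall_pi _ hr] at hx
      exact fun i => hx i (mem_univ _)
    simp [hx, indicator_of_mem (hx' _)]
  · have hx' : ∃ i, x i ∉ Metric.closedBall (y i) r := by
      rw [closedBall_pi _ hr] at hx
      simpa using hx
    obtain ⟨i, hi⟩ := hx'
    rw [indicator_of_notMem hx, Finset.prod_eq_zero (Finset.mem_univ i)]
    rw [indicator_of_notMem hi]

section JN

variable {n : ℕ}

lemma vol_cube (x : Fin n → ℝ) {r : ℝ} (hr : 0 ≤ r) :
    volume (Metric.closedBall x r) = ENNReal.ofReal (2 * r) ^ n := by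
  rw [Real.volume_pi_closedBall x hr, Fintype.card_fin, ENNReal.ofReal_pow (by positivity)]

lemma vol_cube_smul (x z : Fin n → ℝ) {r : ℝ} (hr : 0 ≤ r) (k : ℕ) :
    volume (Metric.closedBall z (k * r)) = (k : ℝ≥0∞) ^ n * volume (Metric.closedBall x r) := by
  rw [vol_cube _ (by positivity), vol_cube _ hr, ← mul_pow]
  congr 1
  rw [mul_left_comm, ENNReal.ofReal_mul (by positivity), ENNReal.ofReal_natCast]

lemma vol_cube_pos (x : Fin n → ℝ) {r : ℝ} (hr : 0 < r) :
    volume (Metric.closedBall x r) ≠ 0 := (Metric.measure_closedBall_pos volume x hr).ne'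

lemma vol_cube_fin (x : Fin n → ℝ) (r : ℝ) :
    volume (Metric.closedBall x r) ≠ ∞ := measure_closedBall_lt_top.ne

lemma const_diff {b : (Fin n → ℝ) → ℝ} (hb : Measurable b) (c₁ c₂ : ℝ) (S : Set (Fin n → ℝ)) :
    ‖c₁ - c₂‖ₑ * volume S ≤ (∫⁻ z in S, ‖b z - c₁‖ₑ) + ∫⁻ z in S, ‖b z - c₂‖ₑ := by
  rw [← lintegral_add_left (by fun_prop), ← setLIntegral_const]
  apply lintegral_mono
  intro z
  have : c₁ - c₂ = (b z - c₂) - (b z - c₁) := by ring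
  show ‖c₁ - c₂‖ₑ ≤ ‖b z - c₁‖ₑ + ‖b z - c₂‖ₑ
  rw [this, add_comm]
  exact enorm_sub_le

lemma enorm_tri (u v w : ℝ) : ‖u - w‖ₑ ≤ ‖u - v‖ₑ + ‖v - w‖ₑ := by
  have : u - w = (u - v) + (v - w) := by ring
  rw [this]
  exact enorm_add_le _ _

/-- One step of the John-Nirenberg iteration. -/
lemma jn_step {b : (Fin n → ℝ) → ℝ} (hb : Measurable b) (a : (Fin n → ℝ) → ℝ → ℝ)
    {D : ℝ≥0∞} (hD0 : D ≠ 0) (hD : D ≠ ∞)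
    (hosc : ∀ x r, 0 < r → ∫⁻ z in Metric.closedBall x r, ‖b z - a x r‖ₑ ≤
      D * volume (Metric.closedBall x r))
    (A l : ℝ≥0∞)
    (hA : ∀ x r, 0 < r → volume {z ∈ Metric.closedBall x r | l < ‖b z - a x r‖ₑ} ≤
      A * volume (Metric.closedBall x r)) (x : Fin n → ℝ) (r : ℝ) (hr : 0 < r) :
    volume {z ∈ Metric.closedBall x r | l + 3 * (2 * 10 ^ n * D) < ‖b z - a x r‖ₑ} ≤
      A * 2⁻¹ * volume (Metric.closedBall x r) := by
  set T : ℝ≥0∞ := 2 * 10 ^ n * D with hT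
  set c := a x (2 * r) with hc
  set V := volume (Metric.closedBall x r) with hV
  have hV0 : V ≠ 0 := vol_cube_pos x hr
  have hVf : V ≠ ∞ := vol_cube_fin x r
  have hTf : T ≠ ∞ := by
    rw [hT]; exact ENNReal.mul_ne_top (ENNReal.mul_ne_top (by simp) (by simp)) hD
  have hT0 : T ≠ 0 := by
    rw [hT]; exact mul_ne_zero (by positivity) hD0
  have hDT : D + 2 ^ n * D ≤ T := by
    have h1 : (1 : ℝ≥0∞) ≤ 10 ^ n := one_le_pow₀ (by norm_num)
    have h2 : (2 : ℝ≥0∞) ^ n ≤ 10 ^ n := by gcongr; norm_num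
    calc D + 2 ^ n * D = (1 + 2 ^ n) * D := by ring
      _ ≤ (10 ^ n + 10 ^ n) * D := by gcongr
      _ = T := by rw [hT]; ring
  have hDT' : D ≤ T := le_self_add.trans hDT
  have hV2 : volume (Metric.closedBall x (2 * r)) = 2 ^ n * V := by
    simpa using vol_cube_smul x x hr.le 2
  let g : (Fin n → ℝ) → ℝ≥0∞ := (Metric.closedBall x (2 * r)).indicator fun z => ‖b z - c‖ₑ
  have hgm : Measurable g := (by fun_prop : Measurable fun z => ‖b z - c‖ₑ).indicator
    measurableSet_closedBall
  have hgint : ∫⁻ z, g z ≤ 2 ^ n * D * V := by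
    rw [lintegral_indicator measurableSet_closedBall]
    refine (hosc x (2 * r) (by positivity)).trans_eq ?_
    rw [hV2]; ring
  have hgfin : ∫⁻ z, g z ≠ ∞ := ne_top_of_le_ne_top
    (ENNReal.mul_ne_top (ENNReal.mul_ne_top (by simp) hD) hVf) hgint
  have hgeq : ∀ z ∈ Metric.closedBall x (2 * r), g z = ‖b z - c‖ₑ := fun z hz =>
    indicator_of_mem hz _
  -- stopping radii
  let R : (Fin n → ℝ) → ℝ → Prop := fun z ρ =>
    0 < ρ ∧ T * volume (Metric.closedBall z ρ) < ∫⁻ w in Metric.closedBall z ρ, g w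
  have hRbd : ∀ z ρ, R z ρ → 5 * ρ ≤ r := by
    intro z ρ h
    by_contra hcon
    push Not at hcon
    have h1 : V ≤ 5 ^ n * volume (Metric.closedBall z ρ) := by
      have := vol_cube_smul z x h.1.le 5
      push_cast at this
      rw [← this]
      exact measure_mono (Metric.closedBall_subset_closedBall hcon.le)
    have h2 : ∫⁻ w in Metric.closedBall z ρ, g w ≤ T * volume (Metric.closedBall z ρ) := by
      calc _ ≤ ∫⁻ w, g w := setLIntegral_le_lintegral _ _
        _ ≤ 2 ^ n * D * V := hgint
        _ ≤ 2 ^ n * D * (5 ^ n * volume (Metric.closedBall z ρ)) := by gcongr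
        _ = (2 * 5) ^ n * D * volume (Metric.closedBall z ρ) := by rw [mul_pow]; ring
        _ ≤ T * volume (Metric.closedBall z ρ) := by
          gcongr
          rw [hT]
          gcongr
          norm_num
          exact le_mul_of_one_le_left (by positivity) (by norm_num)
    exact absurd h.2 (not_lt.2 h2)
  have hrad : ∀ z, (∃ ρ, R z ρ) → ∃ ρ, R z ρ ∧ ¬ R z (5 * ρ) := by
    rintro z ⟨ρ, hρ⟩
    by_contra hcon
    push Not at hcon
    have hall : ∀ k : ℕ, R z (5 ^ k * ρ) := by
      intro k
      induction k with
      | zero => simpa using hρ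
      | succ k ih =>
        have := hcon _ ih
        rwa [← mul_assoc, ← pow_succ'] at this
    obtain ⟨k, hk⟩ := pow_unbounded_of_one_lt (r / ρ) (by norm_num : (1 : ℝ) < 5)
    have h1 := hRbd z _ (hall k)
    rw [div_lt_iff₀ hρ.1] at hk
    nlinarith [(hall k).1]
  choose! ρ hρ using hrad
  let t : Set (Fin n → ℝ) := {z | z ∈ Metric.closedBall x r ∧ ∃ ρ, R z ρ}
  have hρR : ∀ z ∈ t, R z (ρ z) := fun z hz => (hρ z hz.2).1
  have hρN : ∀ z ∈ t, ¬ R z (5 * ρ z) := fun z hz => (hρ z hz.2).2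
  obtain ⟨u, hut, hud, hucov⟩ := Vitali.exists_disjoint_subfamily_covering_enlargement_closedBall
    t id ρ r (fun z hz => by
      have := hRbd z _ (hρR z hz)
      linarith [(hρR z hz).1]) 5 (by norm_num)
  simp only [id] at hud hucov
  have hucount : u.Countable := by
    refine hud.countable_of_nonempty_interior fun z hz => ?_
    exact ⟨z, Metric.ball_subset_interior_closedBall (Metric.mem_ball_self (hρR z (hut hz)).1)⟩
  -- total mass
  have hmass : ∑' z : u, volume (Metric.closedBall (z : Fin n → ℝ) (ρ z)) ≤ T⁻¹ * (2 ^ n * D * V) := by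
    have h1 : T * ∑' z : u, volume (Metric.closedBall (z : Fin n → ℝ) (ρ z)) ≤ 2 ^ n * D * V := by
      rw [← ENNReal.tsum_mul_left]
      calc _ ≤ ∑' z : u, ∫⁻ w in Metric.closedBall (z : Fin n → ℝ) (ρ z), g w :=
            ENNReal.tsum_le_tsum fun z => (hρR z (hut z.2)).2.le
        _ = ∫⁻ w in ⋃ z ∈ u, Metric.closedBall (z : Fin n → ℝ) (ρ z), g w :=
            (lintegral_biUnion hucount (fun z _ => measurableSet_closedBall) hud g).symm
        _ ≤ ∫⁻ w, g w := setLIntegral_le_lintegral _ _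
        _ ≤ _ := hgint
    calc _ = T⁻¹ * (T * ∑' z : u, volume (Metric.closedBall (z : Fin n → ℝ) (ρ z))) := by
          rw [← mul_assoc, ENNReal.inv_mul_cancel hT0 hTf, one_mul]
      _ ≤ _ := by gcongr
  -- close constants
  have hcx : ‖c - a x r‖ₑ ≤ T := by
    have h1 := const_diff hb c (a x r) (Metric.closedBall x r)
    have h2 : (∫⁻ z in Metric.closedBall x r, ‖b z - c‖ₑ) ≤ 2 ^ n * D * V := by
      refine (lintegral_mono_set (Metric.closedBall_subset_closedBall (by linarith))).trans
        ((hosc x (2 * r) (by positivity)).trans_eq ?_)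
      rw [hV2]; ring
    have h3 : ‖c - a x r‖ₑ * V ≤ T * V := by
      calc _ ≤ 2 ^ n * D * V + D * V := h1.trans (add_le_add h2 (hosc x r hr))
        _ = (D + 2 ^ n * D) * V := by ring
        _ ≤ T * V := by gcongr
    exact (ENNReal.mul_le_mul_iff_left hV0 hVf).1 h3
  have hcu : ∀ z ∈ u, ‖a z (5 * ρ z) - c‖ₑ ≤ 2 * T := by
    intro z hz
    have hzp := (hρR z (hut hz)).1
    have h5 := hRbd z _ (hρR z (hut hz))
    have hzx := (hut hz).1
    set W := volume (Metric.closedBall z (5 * ρ z)) with hW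
    have h1 := const_diff hb (a z (5 * ρ z)) c (Metric.closedBall z (5 * ρ z))
    have h2 : (∫⁻ w in Metric.closedBall z (5 * ρ z), ‖b w - c‖ₑ) ≤ T * W := by
      have hN := hρN z (hut hz)
      have h3 : ∫⁻ w in Metric.closedBall z (5 * ρ z), g w ≤ T * W := by
        by_contra hcon
        exact hN ⟨by positivity, not_le.1 hcon⟩
      refine le_of_eq_of_le (setLIntegral_congr_fun measurableSet_closedBall fun w hw => ?_) h3
      refine (hgeq w ?_).symm
      refine Metric.closedBall_subset_closedBall' ?_ hw
      have := Metric.mem_closedBall.1 hzx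
      linarith
    have h3 : ‖a z (5 * ρ z) - c‖ₑ * W ≤ (2 * T) * W := by
      calc _ ≤ D * W + T * W := h1.trans (add_le_add (hosc z _ (by positivity)) h2)
        _ ≤ T * W + T * W := by gcongr
        _ = _ := by ring
    exact (ENNReal.mul_le_mul_iff_left (vol_cube_pos z (by positivity)) (vol_cube_fin z _)).1 h3
  -- differentiation
  have hdiff := (Besicovitch.vitaliFamily (volume : Measure (Fin n → ℝ))).ae_tendsto_lintegral_div'
    hgm hgfin
  let S : Set (Fin n → ℝ) := {z ∈ Metric.closedBall x r | l + 3 * T < ‖b z - a x r‖ₑ}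
  let U : Set (Fin n → ℝ) := ⋃ z ∈ u, {w ∈ Metric.closedBall z (5 * ρ z) |
      l < ‖b w - a z (5 * ρ z)‖ₑ}
  have hSU : S ≤ᵐ[volume] U := by
    filter_upwards [hdiff] with z hz hzS
    have hzx : z ∈ Metric.closedBall x r := hzS.1
    have hzl : l + 3 * T < ‖b z - a x r‖ₑ := hzS.2
    have hlt : l + 2 * T < ‖b z - c‖ₑ := by
      by_contra hcon
      push Not at hcon
      refine absurd hzl (not_lt.2 ?_)
      calc _ ≤ ‖b z - c‖ₑ + ‖c - a x r‖ₑ := enorm_tri _ _ _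
        _ ≤ (l + 2 * T) + T := add_le_add hcon hcx
        _ = _ := by ring
    have hgz : g z = ‖b z - c‖ₑ := hgeq z (Metric.closedBall_subset_closedBall (by linarith) hzx)
    have hTg : T < g z := by
      rw [hgz]
      refine lt_of_le_of_lt ?_ hlt
      calc T ≤ 2 * T := le_mul_of_one_le_left (by positivity) (by norm_num)
        _ ≤ _ := le_add_self
    have hten := hz.comp (Besicovitch.tendsto_filterAt volume z)
    have hev := hten.eventually (lt_mem_nhds hTg)
    obtain ⟨s, hs, hs0⟩ := (hev.and self_mem_nhdsWithin).exists
    have hs0' : 0 < s := hs0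
    have hRs : R z s := by
      refine ⟨hs0', ?_⟩
      simp only [Function.comp] at hs
      rwa [ENNReal.lt_div_iff_mul_lt (Or.inl (vol_cube_pos z hs0'))
        (Or.inl (vol_cube_fin z s))] at hs
    have hzt : z ∈ t := ⟨hzx, s, hRs⟩
    obtain ⟨w, hwu, hw⟩ := hucov z hzt
    have hzw : z ∈ Metric.closedBall w (5 * ρ w) :=
      hw (Metric.mem_closedBall_self (hρR z hzt).1.le)
    refine mem_iUnion₂.2 ⟨w, hwu, hzw, ?_⟩
    by_contra hcon
    push Not at hcon
    refine absurd hlt (not_lt.2 ?_)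
    exact (enorm_tri _ (a w (5 * ρ w)) _).trans (add_le_add hcon (hcu w hwu))
  calc volume S ≤ volume U := measure_mono_ae hSU
    _ ≤ ∑' z : u, volume {w ∈ Metric.closedBall (z : Fin n → ℝ) (5 * ρ z) |
      l < ‖b w - a z (5 * ρ z)‖ₑ} := measure_biUnion_le _ hucount _
    _ ≤ ∑' z : u, A * (5 ^ n * volume (Metric.closedBall (z : Fin n → ℝ) (ρ z))) := by
      refine ENNReal.tsum_le_tsum fun z => ?_
      have hzp := (hρR z (hut z.2)).1
      refine (hA z _ (by positivity)).trans_eq ?_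
      have := vol_cube_smul (z : Fin n → ℝ) z hzp.le 5
      push_cast at this
      rw [this]
    _ = A * (5 ^ n * ∑' z : u, volume (Metric.closedBall (z : Fin n → ℝ) (ρ z))) := by
      rw [ENNReal.tsum_mul_left, ENNReal.tsum_mul_left]
    _ ≤ A * (5 ^ n * (T⁻¹ * (2 ^ n * D * V))) := by gcongr
    _ = A * ((10 ^ n * D) * T⁻¹) * V := by
      have : (10 : ℝ≥0∞) ^ n = 5 ^ n * 2 ^ n := by rw [← mul_pow]; norm_num
      rw [this]; ring
    _ = A * 2⁻¹ * V := by
      have h10 : (10 ^ n * D) ≠ 0 := mul_ne_zero (by positivity) hD0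
      have h10' : (10 ^ n * D) ≠ ∞ := ENNReal.mul_ne_top (by simp) hD
      have : T = 2 * (10 ^ n * D) := by rw [hT]; ring
      rw [this, ENNReal.mul_inv (by simp) (by simp), mul_left_comm (10 ^ n * D),
        ENNReal.mul_inv_cancel h10 h10', mul_one]

lemma jn {b : (Fin n → ℝ) → ℝ} (hb : Measurable b) (a : (Fin n → ℝ) → ℝ → ℝ)
    {D : ℝ≥0∞} (hD0 : D ≠ 0) (hD : D ≠ ∞)
    (hosc : ∀ x r, 0 < r → ∫⁻ z in Metric.closedBall x r, ‖b z - a x r‖ₑ ≤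
      D * volume (Metric.closedBall x r)) (m : ℕ) : ∀ (x : Fin n → ℝ) (r : ℝ), 0 < r →
    volume {z ∈ Metric.closedBall x r | m * (3 * (2 * 10 ^ n * D)) < ‖b z - a x r‖ₑ} ≤
      2⁻¹ ^ m * volume (Metric.closedBall x r) := by
  induction m with
  | zero =>
    intro x r hr
    rw [pow_zero, one_mul]
    exact measure_mono fun z hz => hz.1
  | succ m ih =>
    intro x r hr
    have := jn_step hb a hD0 hD hosc _ _ ih x r hr
    rw [pow_succ]
    have e : ((m + 1 : ℕ) : ℝ≥0∞) * (3 * (2 * 10 ^ n * D)) =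
        m * (3 * (2 * 10 ^ n * D)) + 3 * (2 * 10 ^ n * D) := by
      push_cast
      rw [add_mul, one_mul]
    rw [e]
    exact this

lemma layercake {Q : Set (Fin n → ℝ)} (hQ : MeasurableSet Q) {f : (Fin n → ℝ) → ℝ≥0∞}
    (hf : Measurable f) (hff : ∀ z, f z ≠ ∞) (P : ℕ) {K : ℝ≥0∞} (hK0 : K ≠ 0) (hK : K ≠ ∞)
    (h : ∀ m : ℕ, volume {z ∈ Q | (m + 1) * K < f z} ≤ 2⁻¹ ^ m * volume Q) :
    ∫⁻ z in Q, f z ^ P ≤ K ^ P * (1 + ∑' m : ℕ, ((m : ℝ≥0∞) + 2) ^ P * 2⁻¹ ^ m) * volume Q := by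
  have hpt : ∀ z, f z ^ P ≤ K ^ P + ∑' m : ℕ, ((m + 2) * K) ^ P *
      ({z | (m + 1) * K < f z}.indicator 1 z) := by
    intro z
    by_cases hz : f z ≤ K
    · exact (pow_le_pow_left₀ (by positivity) hz P).trans le_self_add
    · push Not at hz
      have hex : ∃ m : ℕ, f z ≤ (m + 1) * K := by
        obtain ⟨m, hm⟩ := ENNReal.exists_nat_gt (ENNReal.div_ne_top (hff z) hK0)
        refine ⟨m, ?_⟩
        rw [ENNReal.div_lt_iff (Or.inl hK0) (Or.inl hK)] at hm
        refine hm.le.trans ?_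
        gcongr
        exact le_self_add
      classical
      obtain ⟨k, hk⟩ : ∃ k, Nat.find hex = k + 1 := by
        refine Nat.exists_eq_succ_of_ne_zero fun h0 => ?_
        have := Nat.find_spec hex
        rw [h0] at this
        simp at this
        exact absurd hz (not_lt.2 this)
      have h1 := Nat.find_spec hex
      rw [hk] at h1
      have h2 : (k + 1) * K < f z := by
        have := Nat.find_min hex (m := k) (by omega)
        exact not_le.1 this
      calc f z ^ P ≤ ((k + 2) * K) ^ P := by
            refine pow_le_pow_left₀ (by positivity) (h1.trans_eq ?_) P
            push_cast; ring
        _ = ((k + 2) * K) ^ P * ({z | (k + 1) * K < f z}.indicator 1 z) := by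
            rw [indicator_of_mem (show z ∈ {z | (k + 1) * K < f z} from h2)]; simp
        _ ≤ _ := ENNReal.le_tsum (f := fun m : ℕ => ((m + 2) * K) ^ P *
            ({z | (m + 1) * K < f z}.indicator (1 : (Fin n → ℝ) → ℝ≥0∞) z)) k
        _ ≤ _ := le_add_self
  have hms : ∀ m : ℕ, MeasurableSet {z | (m + 1) * K < f z} := fun m =>
    measurableSet_lt measurable_const hf
  calc _ ≤ ∫⁻ z in Q, (K ^ P + ∑' m : ℕ, ((m + 2) * K) ^ P *
      ({z | (m + 1) * K < f z}.indicator 1 z)) := lintegral_mono fun z => hpt z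
    _ = K ^ P * volume Q + ∑' m : ℕ, ((m + 2) * K) ^ P * volume {z ∈ Q | (m + 1) * K < f z} := by
      rw [lintegral_add_left measurable_const, setLIntegral_const, lintegral_tsum]
      · congr 2; ext m
        rw [lintegral_const_mul _ (measurable_one.indicator (hms m)),
          lintegral_indicator_one (hms m), Measure.restrict_apply (hms m)]
        congr 2; ext z; simp [and_comm]
      · intro m
        exact ((measurable_one.indicator (hms m)).const_mul _).aemeasurable
    _ ≤ K ^ P * volume Q + ∑' m : ℕ, ((m + 2) * K) ^ P * (2⁻¹ ^ m * volume Q) := by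
      gcongr with m
      exact h m
    _ = _ := by
      have : ∀ m : ℕ, ((m + 2) * K) ^ P * (2⁻¹ ^ m * volume Q) =
        (K ^ P * volume Q) * (((m : ℝ≥0∞) + 2) ^ P * 2⁻¹ ^ m) := fun m => by rw [mul_pow]; ring
      simp_rw [this]
      rw [ENNReal.tsum_mul_left]
      ring

lemma series_fin (P : ℕ) : 1 + ∑' m : ℕ, ((m : ℝ≥0∞) + 2) ^ P * 2⁻¹ ^ m ≠ ∞ := by
  have h1 : Summable fun m : ℕ => (((m + 2 : ℕ) : ℝ)) ^ P * (1 / 2) ^ m := by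
    have := summable_pow_mul_geometric_of_norm_lt_one (R := ℝ) P (r := 1 / 2) (by norm_num)
    have h2 := (summable_nat_add_iff 2).2 this
    have h3 := h2.mul_left 4
    refine h3.congr fun m => ?_
    rw [pow_add]; push_cast; ring
  refine ENNReal.add_ne_top.2 ⟨by simp, ?_⟩
  have : ∀ m : ℕ, ((m : ℝ≥0∞) + 2) ^ P * 2⁻¹ ^ m =
      ENNReal.ofReal ((((m + 2 : ℕ) : ℝ)) ^ P * (1 / 2) ^ m) := by
    intro m
    rw [ENNReal.ofReal_mul (by positivity), ENNReal.ofReal_pow (by positivity),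
      ENNReal.ofReal_pow (by positivity), ENNReal.ofReal_natCast]
    congr 2
    · push_cast; rfl
    · rw [one_div, ENNReal.ofReal_inv_of_pos (by norm_num)]; simp
  simp_rw [this]
  exact h1.tsum_ofReal_ne_top

end JN

section Final

lemma eball_sub (n : ℕ) (y : Fin n → ℝ) {r : ℝ} (hr : 0 < r) :
    eball n y r ⊆ Metric.closedBall y r := by
  intro x hx
  rw [Metric.mem_closedBall, dist_pi_le_iff hr.le]
  intro i
  rw [Real.dist_eq, ← Real.sqrt_sq_eq_abs]
  refine le_trans (Real.sqrt_le_sqrt ?_) (le_of_lt hx)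
  exact Finset.single_le_sum (f := fun i => (x i - y i) ^ 2) (fun i _ => sq_nonneg _)
    (Finset.mem_univ i)

lemma sub_eball (n : ℕ) (y : Fin n → ℝ) {r : ℝ} (hr : 0 < r) :
    Metric.closedBall y r ⊆ eball n y (((n + 1 : ℕ) : ℝ) * r) := by
  intro x hx
  rw [Metric.mem_closedBall, dist_pi_le_iff hr.le] at hx
  show Real.sqrt _ < _
  rw [Real.sqrt_lt' (by positivity)]
  calc ∑ i, (x i - y i) ^ 2 ≤ ∑ i : Fin n, r ^ 2 := by
        refine Finset.sum_le_sum fun i _ => ?_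
        have := hx i
        rw [Real.dist_eq] at this
        exact sq_le_sq' (by linarith [abs_le.1 this]) (by linarith [abs_le.1 this])
    _ = n * r ^ 2 := by simp
    _ < _ := by
        push_cast
        have : 0 < r ^ 2 := by positivity
        have hn : (0 : ℝ) ≤ n := by positivity
        nlinarith [mul_nonneg hn this.le, mul_nonneg (mul_nonneg hn hn) this.le]

lemma meas_eball (n : ℕ) (y : Fin n → ℝ) (r : ℝ) : MeasurableSet (eball n y r) := by
  apply measurableSet_lt
  · fun_prop
  · fun_prop

lemma sub_eball' (n : ℕ) (y : Fin n → ℝ) {r : ℝ} (hr : 0 < r) :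
    Metric.closedBall y (r / (n + 1 : ℕ)) ⊆ eball n y r := by
  have := sub_eball n y (r := r / (n + 1 : ℕ)) (by positivity)
  rwa [mul_div_cancel₀ _ (by positivity)] at this

lemma vol_le_eball (n : ℕ) (y : Fin n → ℝ) {r : ℝ} (hr : 0 < r) :
    volume (Metric.closedBall y r) ≤ ((n + 1 : ℕ) : ℝ≥0∞) ^ n * volume (eball n y r) := by
  have h := vol_cube_smul y y (r := r / (n + 1 : ℕ)) (by positivity) (n + 1)
  rw [mul_div_cancel₀ _ (by positivity)] at h
  rw [h]
  gcongr
  exact sub_eball' n y hr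

lemma eball_vol_le (n : ℕ) (y : Fin n → ℝ) {r : ℝ} (hr : 0 < r) :
    volume (eball n y (((n + 1 : ℕ) : ℝ) * r)) ≤
      ((n + 1 : ℕ) : ℝ≥0∞) ^ n * volume (Metric.closedBall y r) := by
  rw [← vol_cube_smul y y hr.le (n + 1)]
  exact measure_mono (eball_sub n y (by positivity))

lemma eball_ne_top (n : ℕ) (y : Fin n → ℝ) {r : ℝ} (hr : 0 < r) : volume (eball n y r) ≠ ∞ :=
  ne_top_of_le_ne_top (vol_cube_fin y r) (measure_mono (eball_sub n y hr))

lemma eball_ne_zero (n : ℕ) (y : Fin n → ℝ) {r : ℝ} (hr : 0 < r) : volume (eball n y r) ≠ 0 := by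
  intro h
  have := measure_mono_null (sub_eball' n y hr) h
  exact vol_cube_pos y (by positivity) this

lemma osc_eq (n : ℕ) {b : (Fin n → ℝ) → ℝ} (hb : LocallyIntegrable b volume) (c : ℝ)
    (y : Fin n → ℝ) {r : ℝ} (hr : 0 < r) :
    ENNReal.ofReal ((volume (eball n y r)).toReal⁻¹ * ∫ x in eball n y r, |b x - c|) =
      (volume (eball n y r))⁻¹ * ∫⁻ x in eball n y r, ‖b x - c‖ₑ := by
  have hi : IntegrableOn b (eball n y r) :=
    (hb.integrableOn_isCompact (isCompact_closedBall y r)).mono_set (eball_sub n y hr)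
  have hi2 : IntegrableOn (fun x => b x - c) (eball n y r) :=
    hi.sub (integrableOn_const (eball_ne_top n y hr))
  rw [ENNReal.ofReal_mul (by positivity), ENNReal.ofReal_inv_of_pos
    (ENNReal.toReal_pos (eball_ne_zero n y hr) (eball_ne_top n y hr)),
    ENNReal.ofReal_toReal (eball_ne_top n y hr)]
  congr 1
  exact ofReal_integral_norm_eq_lintegral_enorm hi2

lemma osc_le (n : ℕ) {b : (Fin n → ℝ) → ℝ} (hb : LocallyIntegrable b volume)
    (y : Fin n → ℝ) {r : ℝ} (hr : 0 < r) :
    ∫⁻ x in eball n y r, ‖b x - ballAvg n b y r‖ₑ ≤ bmoNorm n b * volume (eball n y r) := by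
  have h : (volume (eball n y r))⁻¹ * ∫⁻ x in eball n y r, ‖b x - ballAvg n b y r‖ₑ ≤
      bmoNorm n b := by
    rw [← osc_eq n hb _ y hr, bmoNorm]
    exact le_iSup_of_le y (le_iSup_of_le r (le_iSup_of_le hr le_rfl))
  rw [← ENNReal.div_eq_inv_mul] at h
  rwa [ENNReal.div_le_iff (eball_ne_zero n y hr) (eball_ne_top n y hr)] at h

lemma mixedLp_indicator (n : ℕ) (p : Fin n → ℝ≥0∞) (S : Set (Fin n → ℝ))
    (f : (Fin n → ℝ) → ℝ) :
    mixedLp n p (S.indicator f) = mixedE n p (S.indicator fun x => ‖f x‖ₑ) := by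
  unfold mixedLp
  congr 1; ext x
  by_cases hx : x ∈ S <;> simp [hx, enorm]

lemma boxN_scale (n : ℕ) (p : Fin n → ℝ≥0∞) (hp : ∀ i, 1 < p i ∧ p i < ∞) (L M : ℝ≥0∞) (k : ℕ)
    (hk : 1 ≤ k) (h : M = k * L) : boxN n p M ≤ (k : ℝ≥0∞) ^ n * boxN n p L := by
  have : (k : ℝ≥0∞) ^ n = ∏ _i : Fin n, (k : ℝ≥0∞) := by simp
  rw [this, boxN, boxN, ← Finset.prod_mul_distrib]
  refine Finset.prod_le_prod' fun i _ => ?_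
  rw [h, ENNReal.mul_rpow_of_nonneg _ _ (by positivity)]
  gcongr
  have h1 : (1 : ℝ≥0∞) ≤ k := by exact_mod_cast hk
  have h2 : 1 ≤ (p i).toReal := by
    have := ENNReal.toReal_mono (hp i).2.ne (hp i).1.le
    simpa using this
  calc (k : ℝ≥0∞) ^ (1 / (p i).toReal) ≤ (k : ℝ≥0∞) ^ (1 : ℝ) :=
        ENNReal.rpow_le_rpow_of_exponent_le h1 (by rw [div_le_one (by linarith)]; exact h2)
    _ = k := by simp

lemma holder_cube (n : ℕ) (q s : Fin n → ℝ≥0∞)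
    (hq : ∀ i, q i ≠ 0) (hqs : ∀ i, q i ≤ s i) (hs : ∀ i, s i ≠ ∞) (y : Fin n → ℝ) {r : ℝ}
    (hr : 0 < r) {S : Set (Fin n → ℝ)} (hSm : MeasurableSet S) (hS : S ⊆ Metric.closedBall y r)
    {g : (Fin n → ℝ) → ℝ≥0∞} (hg : Measurable g) :
    mixedE n q (S.indicator g) * boxN n s (ENNReal.ofReal (2 * r)) ≤
      boxN n q (ENNReal.ofReal (2 * r)) * mixedE n s (S.indicator g) := by
  refine mixedE_holder ENNReal.ofReal_ne_top n q s hq hqs hs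
    (fun i => Metric.closedBall (y i) r) (fun i => measurableSet_closedBall)
    (fun i => Real.volume_closedBall _ _) (hg.indicator hSm) ?_
  intro x i hx
  refine indicator_of_notMem (fun hxS => hx ?_) _
  have := hS hxS
  rw [closedBall_pi _ hr.le] at this
  exact this i (mem_univ i)

lemma lower_meas (n : ℕ) (p : Fin n → ℝ≥0∞) (hp : ∀ i, 1 < p i ∧ p i < ∞)
    {b : (Fin n → ℝ) → ℝ} (hbm : Measurable b) (hb : LocallyIntegrable b volume) :
    (((n + 1 : ℕ) : ℝ≥0∞) ^ n)⁻¹ * bmoNorm n b ≤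
      ⨆ (y : Fin n → ℝ) (r : ℝ) (_ : 0 < r),
            mixedLp n p ((eball n y r).indicator fun x => b x - ballAvg n b y r) /
              mixedLp n p ((eball n y r).indicator fun _ => (1 : ℝ)) := by
  have hp0 : ∀ i, p i ≠ 0 := fun i => (zero_lt_one.trans (hp i).1).ne'
  have hpt : ∀ i, p i ≠ ∞ := fun i => (hp i).2.ne
  rw [← ENNReal.div_eq_inv_mul]
  refine ENNReal.div_le_of_le_mul' ?_
  conv_lhs => rw [bmoNorm]
  refine iSup_le fun y => iSup_le fun r => iSup_le fun hr => ?_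
  have hsup : mixedLp n p ((eball n y r).indicator fun x => b x - ballAvg n b y r) /
      mixedLp n p ((eball n y r).indicator fun _ => (1 : ℝ)) ≤
      ⨆ (y : Fin n → ℝ) (r : ℝ) (_ : 0 < r),
            mixedLp n p ((eball n y r).indicator fun x => b x - ballAvg n b y r) /
              mixedLp n p ((eball n y r).indicator fun _ => (1 : ℝ)) :=
    le_iSup_of_le y (le_iSup_of_le r (le_iSup_of_le hr le_rfl))
  refine le_trans ?_ (mul_le_mul_right hsup _)
  clear hsup
  rw [osc_eq n hb _ y hr, mixedLp_indicator, mixedLp_indicator]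
  set f : (Fin n → ℝ) → ℝ≥0∞ := fun x => ‖b x - ballAvg n b y r‖ₑ with hf
  have hfm : Measurable f := by fun_prop
  set L := ENNReal.ofReal (2 * r) with hL
  have hL0 : L ≠ 0 := by simp [hL, hr]
  have hLt : L ≠ ∞ := ENNReal.ofReal_ne_top
  have hBm := meas_eball n y r
  have h1 := holder_cube n (fun _ => 1) p (by simp) (fun i => (hp i).1.le) hpt y hr hBm
    (eball_sub n y hr) hfm
  rw [mixedE_const 1 (by simp) (by simp) n (hfm.indicator hBm)] at h1
  simp only [ENNReal.toReal_one, ENNReal.rpow_one, div_one] at h1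
  rw [lintegral_indicator hBm, ← hL] at h1
  have e1 : boxN n (fun _ => 1) L = volume (Metric.closedBall y r) := by
    rw [vol_cube y hr.le]; simp [boxN, hL]
  rw [e1] at h1
  have h2 : mixedE n p ((eball n y r).indicator fun _ => ‖(1 : ℝ)‖ₑ) ≤ boxN n p L := by
    rw [← mixedE_cube n p hp0 hpt y hr.le]
    refine mixedE_mono n p hpt fun x => ?_
    simp only [enorm_one]
    exact indicator_le_indicator_of_subset (eball_sub n y hr) (by simp) x
  have hN0 := boxN_ne_zero n p hL0 hLt
  have hNt := boxN_ne_top n p hLt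
  have hB0 := eball_ne_zero n y hr
  have hBt := eball_ne_top n y hr
  calc _ = (∫⁻ x in eball n y r, f x) / volume (eball n y r) := by
        rw [ENNReal.div_eq_inv_mul]
    _ ≤ ((n + 1 : ℕ) : ℝ≥0∞) ^ n * (mixedE n p ((eball n y r).indicator f) / boxN n p L) := by
        refine ENNReal.div_le_of_le_mul ?_
        rw [← ENNReal.mul_le_mul_iff_left hN0 hNt]
        calc _ ≤ _ := h1
          _ ≤ (((n + 1 : ℕ) : ℝ≥0∞) ^ n * volume (eball n y r)) *
              mixedE n p ((eball n y r).indicator f) := by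
            gcongr
            exact vol_le_eball n y hr
          _ = (((n + 1 : ℕ) : ℝ≥0∞) ^ n * volume (eball n y r)) *
              (mixedE n p ((eball n y r).indicator f) / boxN n p L * boxN n p L) := by
            rw [ENNReal.div_mul_cancel hN0 hNt]
          _ = _ := by ring
    _ ≤ _ := by gcongr

lemma upper_meas (n : ℕ) (p : Fin n → ℝ≥0∞) (hp : ∀ i, 1 < p i ∧ p i < ∞) :
    ∃ C : ℝ≥0∞, C ≠ ∞ ∧ ∀ b : (Fin n → ℝ) → ℝ, Measurable b → LocallyIntegrable b volume →
      ∀ D, D ≠ ∞ → bmoNorm n b < D →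
      (⨆ (y : Fin n → ℝ) (r : ℝ) (_ : 0 < r),
            mixedLp n p ((eball n y r).indicator fun x => b x - ballAvg n b y r) /
              mixedLp n p ((eball n y r).indicator fun _ => (1 : ℝ))) ≤ C * D := by
  have hp0 : ∀ i, p i ≠ 0 := fun i => (zero_lt_one.trans (hp i).1).ne'
  have hpt : ∀ i, p i ≠ ∞ := fun i => (hp i).2.ne
  obtain ⟨P, hP1, hPp⟩ : ∃ P : ℕ, 1 ≤ P ∧ ∀ i, p i ≤ P := by
    refine ⟨∑ i, ⌈(p i).toReal⌉₊ + 1, by omega, fun i => ?_⟩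
    have h1 : (p i).toReal ≤ ((∑ i, ⌈(p i).toReal⌉₊ + 1 : ℕ) : ℝ) := by
      refine (Nat.le_ceil _).trans ?_
      have := Finset.single_le_sum (f := fun i => ⌈(p i).toReal⌉₊) (fun i _ => Nat.zero_le _)
        (Finset.mem_univ i)
      exact_mod_cast this.trans (Nat.le_succ _)
    rw [← ENNReal.ofReal_toReal (hpt i), ← ENNReal.ofReal_natCast]
    exact ENNReal.ofReal_le_ofReal h1
  set k : ℝ≥0∞ := ((n + 1 : ℕ) : ℝ≥0∞) ^ n with hk
  have hk1 : 1 ≤ k := one_le_pow₀ (by exact_mod_cast Nat.succ_le_succ (Nat.zero_le n))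
  have hkt : k ≠ ∞ := by simp [hk]
  set Sg : ℝ≥0∞ := 1 + ∑' m : ℕ, ((m : ℝ≥0∞) + 2) ^ P * 2⁻¹ ^ m with hSg
  set K₀ : ℝ≥0∞ := 3 * (2 * 10 ^ n) * (2 * k ^ 2) with hK₀
  have hK₀t : K₀ ≠ ∞ := by
    rw [hK₀]
    refine ENNReal.mul_ne_top (ENNReal.mul_ne_top (by simp) (ENNReal.mul_ne_top (by simp) (by simp)))
      (ENNReal.mul_ne_top (by simp) (ENNReal.pow_ne_top hkt))
  refine ⟨k * K₀ * Sg ^ (1 / (P : ℝ)), ENNReal.mul_ne_top (ENNReal.mul_ne_top hkt hK₀t)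
    (ENNReal.rpow_ne_top_of_nonneg (by positivity) (series_fin P)), ?_⟩
  intro b hbm hb D hDt hD
  have hD0 : D ≠ 0 := (pos_of_gt hD).ne'
  refine iSup_le fun y => iSup_le fun r => iSup_le fun hr => ?_
  refine ENNReal.div_le_of_le_mul ?_
  rw [mixedLp_indicator, mixedLp_indicator]
  set f : (Fin n → ℝ) → ℝ≥0∞ := fun x => ‖b x - ballAvg n b y r‖ₑ with hf
  have hfm : Measurable f := by fun_prop
  set L := ENNReal.ofReal (2 * r) with hL
  have hL0 : L ≠ 0 := by simp [hL, hr]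
  have hLt : L ≠ ∞ := ENNReal.ofReal_ne_top
  set Q := Metric.closedBall y r with hQ
  have hQm : MeasurableSet Q := measurableSet_closedBall
  have hQ0 : volume Q ≠ 0 := vol_cube_pos y hr
  have hQt : volume Q ≠ ∞ := vol_cube_fin y r
  let a : (Fin n → ℝ) → ℝ → ℝ := fun x ρ => ballAvg n b x (((n + 1 : ℕ) : ℝ) * ρ)
  have hosc : ∀ x ρ, 0 < ρ → ∫⁻ z in Metric.closedBall x ρ, ‖b z - a x ρ‖ₑ ≤
      (k * D) * volume (Metric.closedBall x ρ) := by
    intro x ρ hρ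
    calc _ ≤ ∫⁻ z in eball n x (((n + 1 : ℕ) : ℝ) * ρ), ‖b z - a x ρ‖ₑ :=
          lintegral_mono_set (sub_eball n x hρ)
      _ ≤ bmoNorm n b * volume (eball n x (((n + 1 : ℕ) : ℝ) * ρ)) := osc_le n hb x (by positivity)
      _ ≤ D * (k * volume (Metric.closedBall x ρ)) := by
          gcongr
          exact eball_vol_le n x hρ
      _ = _ := by ring
  have hkD0 : k * D ≠ 0 := mul_ne_zero (zero_lt_one.trans_le hk1).ne' hD0
  have hkDt : k * D ≠ ∞ := ENNReal.mul_ne_top hkt hDt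
  have hJN := fun m => jn hbm a hkD0 hkDt hosc m y r hr
  set K := K₀ * D with hK
  have hKt : K ≠ ∞ := ENNReal.mul_ne_top hK₀t hDt
  have h10 : (1 : ℝ≥0∞) ≤ 10 ^ n := one_le_pow₀ (by norm_num)
  have h6 : (1 : ℝ≥0∞) ≤ 3 * (2 * 10 ^ n) :=
    one_le_mul (by norm_num) (one_le_mul (by norm_num) h10)
  have hK1 : 2 * k ^ 2 * D ≤ K := by
    rw [hK, hK₀]
    exact mul_le_mul_left (le_mul_of_one_le_left (by positivity) h6) D
  have hK0 : K ≠ 0 := by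
    refine (lt_of_lt_of_le ?_ hK1).ne'
    rw [pos_iff_ne_zero]
    exact mul_ne_zero (mul_ne_zero (by simp) (pow_ne_zero _ (zero_lt_one.trans_le hk1).ne')) hD0
  have hK2 : 3 * (2 * 10 ^ n * (k * D)) ≤ K := by
    calc _ = 3 * (2 * 10 ^ n) * k * D := by ring
      _ ≤ 3 * (2 * 10 ^ n) * (2 * k ^ 2) * D := by
        gcongr
        calc k ≤ k * k := le_mul_of_one_le_left (by positivity) hk1
          _ ≤ 2 * (k * k) := le_mul_of_one_le_left (by positivity) (by norm_num)
          _ = _ := by ring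
  have hdiff : ‖a y r - ballAvg n b y r‖ₑ ≤ K := by
    refine le_trans ?_ hK1
    have h1 := const_diff hbm (a y r) (ballAvg n b y r) (eball n y r)
    have h2 : ∫⁻ z in eball n y r, ‖b z - a y r‖ₑ ≤ k * D * (k * volume (eball n y r)) :=
      (lintegral_mono_set (eball_sub n y hr)).trans ((hosc y r hr).trans (by
        gcongr
        exact vol_le_eball n y hr))
    have h3 : ∫⁻ z in eball n y r, ‖b z - ballAvg n b y r‖ₑ ≤ D * volume (eball n y r) :=
      (osc_le n hb y hr).trans (by gcongr)
    rw [← ENNReal.mul_le_mul_iff_left (eball_ne_zero n y hr) (eball_ne_top n y hr)]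
    calc _ ≤ _ := h1
      _ ≤ k * D * (k * volume (eball n y r)) + 1 * D * volume (eball n y r) := by
        rw [one_mul]; exact add_le_add h2 h3
      _ ≤ k * D * (k * volume (eball n y r)) + k ^ 2 * D * volume (eball n y r) := by
        gcongr
        exact one_le_pow₀ hk1
      _ = _ := by ring
  have hlc := layercake hQm hfm (fun z => enorm_ne_top) P hK0 hKt (by
    intro m
    refine le_trans (measure_mono ?_) (hJN m)
    rintro z ⟨hzQ, hz⟩
    refine ⟨hzQ, ?_⟩
    by_contra hcon
    push Not at hcon
    refine absurd hz (not_lt.2 ?_)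
    calc f z ≤ ‖b z - a y r‖ₑ + ‖a y r - ballAvg n b y r‖ₑ := enorm_tri _ _ _
      _ ≤ m * K + K := add_le_add (hcon.trans (by gcongr)) hdiff
      _ = _ := by ring)
  have hPpos : (0 : ℝ) < P := by exact_mod_cast hP1
  have hY := holder_cube n p (fun _ => (P : ℝ≥0∞)) hp0 hPp (by simp) y hr hQm subset_rfl hfm
  rw [mixedE_const (P : ℝ≥0∞) (by simp; omega) (by simp) n (hfm.indicator hQm)] at hY
  simp only [ENNReal.toReal_natCast, ENNReal.rpow_natCast] at hY
  have e1 : ∫⁻ x, (Q.indicator f x) ^ P = ∫⁻ x in Q, f x ^ P := by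
    rw [← lintegral_indicator hQm]
    congr 1; ext x
    by_cases hx : x ∈ Q
    · simp [hx]
    · simp [hx]; omega
  have e2 : boxN n (fun _ => (P : ℝ≥0∞)) L = volume Q ^ (1 / (P : ℝ)) := by
    rw [hQ, vol_cube y hr.le, ← hL, ← ENNReal.rpow_natCast, ← ENNReal.rpow_mul,
      mul_comm (n : ℝ), ENNReal.rpow_mul, ENNReal.rpow_natCast]
    simp [boxN]
  rw [e1, ← hL, e2] at hY
  have hroot : (∫⁻ x in Q, f x ^ P) ^ (1 / (P : ℝ)) ≤
      K * Sg ^ (1 / (P : ℝ)) * volume Q ^ (1 / (P : ℝ)) := by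
    calc _ ≤ (K ^ P * Sg * volume Q) ^ (1 / (P : ℝ)) := by gcongr
      _ = _ := by
        rw [ENNReal.mul_rpow_of_nonneg _ _ (by positivity),
          ENNReal.mul_rpow_of_nonneg _ _ (by positivity), ← ENNReal.rpow_natCast,
          ← ENNReal.rpow_mul, mul_one_div_cancel hPpos.ne', ENNReal.rpow_one]
  have hV0 : volume Q ^ (1 / (P : ℝ)) ≠ 0 :=
    (ENNReal.rpow_pos (pos_iff_ne_zero.2 hQ0) hQt).ne'
  have hVt : volume Q ^ (1 / (P : ℝ)) ≠ ∞ := ENNReal.rpow_ne_top_of_nonneg (by positivity) hQt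
  have hYY : mixedE n p (Q.indicator f) ≤ boxN n p L * (K * Sg ^ (1 / (P : ℝ))) := by
    rw [← ENNReal.mul_le_mul_iff_left hV0 hVt]
    calc _ ≤ _ := hY
      _ ≤ boxN n p L * (K * Sg ^ (1 / (P : ℝ)) * volume Q ^ (1 / (P : ℝ))) := by gcongr
      _ = _ := by ring
  have hden : boxN n p L ≤ k * mixedE n p ((eball n y r).indicator fun _ => ‖(1 : ℝ)‖ₑ) := by
    refine (boxN_scale n p hp (ENNReal.ofReal (2 * (r / (n + 1 : ℕ)))) L (n + 1) (by omega) ?_).trans ?_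
    · rw [hL, ← ENNReal.ofReal_natCast, ← ENNReal.ofReal_mul (by positivity)]
      congr 1
      field_simp
    · rw [← mixedE_cube n p hp0 hpt y (by positivity), hk]
      gcongr
      refine mixedE_mono n p hpt fun x => ?_
      simp only [enorm_one]
      exact indicator_le_indicator_of_subset (sub_eball' n y hr) (by simp) x
  calc mixedE n p ((eball n y r).indicator f) ≤ mixedE n p (Q.indicator f) :=
        mixedE_mono n p hpt fun x =>
          indicator_le_indicator_of_subset (eball_sub n y hr) (by simp) x
    _ ≤ _ := hYY
    _ ≤ (k * mixedE n p ((eball n y r).indicator fun _ => ‖(1 : ℝ)‖ₑ)) *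
        (K * Sg ^ (1 / (P : ℝ))) := by gcongr
    _ = _ := by rw [hK]; ring

end Final

/-- Equivalence of the `BMO` norm with the mixed-norm variant:
`‖b‖_{BMO} ∼ sup_B ‖(b - b_B) χ_B‖_{L^{p⃗}} / ‖χ_B‖_{L^{p⃗}}`. -/
theorem statement16 (n : ℕ) (hn : 1 ≤ n) (p : Fin n → ℝ≥0∞)
    (hp : ∀ i, 1 < p i ∧ p i < ∞) :
    ∃ C₁ C₂ : ℝ≥0∞, 0 < C₁ ∧ C₁ ≤ C₂ ∧ C₂ < ∞ ∧
      ∀ b : (Fin n → ℝ) → ℝ, LocallyIntegrable b volume → bmoNorm n b < ∞ →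
        C₁ * bmoNorm n b ≤
          (⨆ (y : Fin n → ℝ) (r : ℝ) (_ : 0 < r),
            mixedLp n p ((eball n y r).indicator fun x => b x - ballAvg n b y r) /
              mixedLp n p ((eball n y r).indicator fun _ => (1 : ℝ))) ∧
        (⨆ (y : Fin n → ℝ) (r : ℝ) (_ : 0 < r),
            mixedLp n p ((eball n y r).indicator fun x => b x - ballAvg n b y r) /
              mixedLp n p ((eball n y r).indicator fun _ => (1 : ℝ))) ≤
          C₂ * bmoNorm n b := by
  obtain ⟨C, hCt, hC⟩ := upper_meas n p hp
  have hpt : ∀ i, p i ≠ ∞ := fun i => (hp i).2.ne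
  have hk1 : (1 : ℝ≥0∞) ≤ ((n + 1 : ℕ) : ℝ≥0∞) ^ n :=
    one_le_pow₀ (by exact_mod_cast Nat.succ_le_succ (Nat.zero_le n))
  refine ⟨(((n + 1 : ℕ) : ℝ≥0∞) ^ n)⁻¹, max 1 C, ?_, ?_, ?_, ?_⟩
  · exact ENNReal.inv_pos.2 (by simp)
  · exact (ENNReal.inv_le_one.2 hk1).trans (le_max_left _ _)
  · exact max_lt (by simp) hCt.lt_top
  intro b hb hbmo
  obtain ⟨b', hb'm, hbb'⟩ : ∃ b' : (Fin n → ℝ) → ℝ, Measurable b' ∧ b =ᵐ[volume] b' := by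
    have h := hb.aestronglyMeasurable.aemeasurable
    exact ⟨h.mk b, h.measurable_mk, h.ae_eq_mk⟩
  have hb'l : LocallyIntegrable b' volume := hb.congr hbb'
  have hav : ∀ y r, ballAvg n b y r = ballAvg n b' y r := by
    intro y r
    unfold ballAvg
    congr 1
    exact integral_congr_ae (ae_restrict_of_ae hbb')
  have hnorm : bmoNorm n b = bmoNorm n b' := by
    unfold bmoNorm
    congr 1; ext y; congr 1; ext r; congr 1; ext hr; congr 2
    refine integral_congr_ae (ae_restrict_of_ae ?_)
    filter_upwards [hbb'] with x hx
    rw [hx, hav]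
  have hmix : ∀ y r, mixedLp n p ((eball n y r).indicator fun x => b x - ballAvg n b y r) =
      mixedLp n p ((eball n y r).indicator fun x => b' x - ballAvg n b' y r) := by
    intro y r
    unfold mixedLp
    refine mixedE_congr_ae n p hpt ?_
    filter_upwards [hbb'] with x hx
    simp only [indicator, hx, hav]
  simp_rw [hmix]
  rw [hnorm] at hbmo ⊢
  refine ⟨lower_meas n p hp hb'm hb'l, ?_⟩
  have hmax : max 1 C ≠ ∞ := (max_lt (by simp) hCt.lt_top).ne
  have hmax0 : max 1 C ≠ 0 := (zero_lt_one.trans_le (le_max_left _ _)).ne'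
  rw [mul_comm, ← ENNReal.div_le_iff hmax0 hmax]
  refine le_of_forall_gt_imp_ge_of_dense fun D hD => ?_
  by_cases hDt : D = ∞
  · rw [hDt]; exact le_top
  rw [ENNReal.div_le_iff hmax0 hmax, mul_comm]
  exact (hC b' hb'm hb'l D hDt hD).trans (by gcongr; exact le_max_right _ _)

end MixedAmalgam

end
end

section
/- Let n ≥ 1, let p⃗, s⃗ be n-tuples and α satisfy 0 ≤ (1/n)Σᵢ 1/sᵢ ≤ 1/α ≤ (1/n)Σᵢ 1/pᵢ < 1, with conjugate exponents p⃗′, s⃗′, α′. There exists a constant C > 0, independent of x₀ and r₀, such that for every ball B(x₀,r₀) ⊂ ℝⁿ the characteristic function χ_{B(x₀,r₀)} satisfies ‖χ_{B(x₀,r₀)}‖_{(L^{p⃗},L^{s⃗})^α} ≤ C·r₀^{n/α} and ‖χ_{B(x₀,r₀)}‖_{H(p⃗′,s⃗′,α′)} ≤ C·r₀^{n/α′}. -/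
open MeasureTheory ENNReal Filter Topology Set

noncomputable section

namespace MixedAmalgam

lemma lpInt_le {p : ℝ≥0∞} (hp : 1 ≤ p) {c : ℝ≥0∞} (hc : c ≠ ∞) (a h : ℝ) 
    (g : ℝ → ℝ≥0∞) (hg : ∀ t, g t ≤ c) (hg0 : ∀ t, h < |t - a| → g t = 0) :
    lpInt p g ≤ c * ENNReal.ofReal (2 * h) ^ (1 / p).toReal := by
  unfold lpInt
  split_ifs with hpt
  · subst hpt
    simp only [one_div, ENNReal.inv_top, ENNReal.toReal_zero, ENNReal.rpow_zero, mul_one]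
    exact essSup_le_of_ae_le _ (ae_of_all _ hg)
  · have hp0 : 0 < p.toReal := ENNReal.toReal_pos (by rintro rfl; simp at hp) hpt
    have h1 : ∫⁻ t, g t ^ p.toReal ≤ c ^ p.toReal * ENNReal.ofReal (2 * h) := by
      calc ∫⁻ t, g t ^ p.toReal
          ≤ ∫⁻ t, (Icc (a - h) (a + h)).indicator (fun _ => c ^ p.toReal) t := by
            apply lintegral_mono
            intro t
            by_cases ht : t ∈ Icc (a - h) (a + h)
            · simp only [indicator_of_mem ht]
              exact ENNReal.rpow_le_rpow (hg t) hp0.le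
            · simp only [indicator_of_notMem ht]
              rw [hg0 t, ENNReal.zero_rpow_of_pos hp0]
              by_contra hcon
              push Not at hcon
              rw [abs_le] at hcon
              exact ht ⟨by linarith, by linarith⟩
        _ = c ^ p.toReal * ENNReal.ofReal (2 * h) := by
            rw [lintegral_indicator_const measurableSet_Icc, Real.volume_Icc]
            congr 2; ring
    calc (∫⁻ t, g t ^ p.toReal) ^ (1 / p.toReal)
        ≤ (c ^ p.toReal * ENNReal.ofReal (2 * h)) ^ (1 / p.toReal) :=
          ENNReal.rpow_le_rpow h1 (by positivity)
      _ = _ := by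
          rw [ENNReal.mul_rpow_of_nonneg _ _ (by positivity), ← ENNReal.rpow_mul,
            mul_one_div_cancel hp0.ne', ENNReal.rpow_one, one_div, one_div, ENNReal.toReal_inv]

lemma invSum_nonneg (n : ℕ) (p : Fin n → ℝ≥0∞) : 0 ≤ invSum n p :=
  Finset.sum_nonneg fun _ _ => ENNReal.toReal_nonneg

lemma mixedE_le (n : ℕ) : ∀ (p : Fin n → ℝ≥0∞), (∀ i, 1 ≤ p i) → ∀ (c : ℝ≥0∞), c ≠ ∞ →
    ∀ (a : Fin n → ℝ) (h : ℝ) (g : (Fin n → ℝ) → ℝ≥0∞), (∀ x, g x ≤ c) →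
    (∀ x, (∃ i, h < |x i - a i|) → g x = 0) →
    mixedE n p g ≤ c * ENNReal.ofReal (2 * h) ^ invSum n p := by
  induction n with
  | zero => 
    intro p _ c _ a h g hg _
    simpa [mixedE, invSum] using hg _
  | succ n ih =>
    intro p hp c hc a h g hg hg0
    have hS := invSum_nonneg n (fun i => p i.castSucc)
    have hfin : c * ENNReal.ofReal (2 * h) ^ invSum n (fun i => p i.castSucc) ≠ ∞ :=
      ENNReal.mul_ne_top hc (ENNReal.rpow_ne_top_of_nonneg hS ENNReal.ofReal_ne_top)
    have key := lpInt_le (hp (Fin.last n)) hfin (a (Fin.last n)) h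
      (fun t => mixedE n (fun i => p i.castSucc) fun x => g (Fin.snoc x t)) ?_ ?_
    · refine key.trans (le_of_eq ?_)
      rw [mul_assoc, ← ENNReal.rpow_add_of_nonneg _ _ hS ENNReal.toReal_nonneg]
      simp [invSum, Fin.sum_univ_castSucc]
    · intro t
      refine ih _ (fun i => hp _) c hc (fun i => a i.castSucc) h _ (fun x => hg _) ?_
      rintro x ⟨i, hi⟩
      exact hg0 _ ⟨i.castSucc, by simpa using hi⟩
    · intro t ht
      have := ih (fun i => p i.castSucc) (fun i => hp _) 0 (by simp) (fun i => a i.castSucc) h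
        (fun x => g (Fin.snoc x t)) 
        (fun x => (hg0 _ ⟨Fin.last n, by simpa using ht⟩).le) 
        (fun x _ => hg0 _ ⟨Fin.last n, by simpa using ht⟩)
      simpa using this

lemma lpSum_le {p : ℝ≥0∞} (hp : 1 ≤ p) {c : ℝ≥0∞} (a : ℤ)
    (g : ℤ → ℝ≥0∞) (hg : ∀ t, g t ≤ c) (hg0 : ∀ t, t ∉ Finset.Icc (a - 1) (a + 1) → g t = 0) :
    lpSum p g ≤ c * 3 := by
  unfold lpSum
  split_ifs with hpt
  · refine iSup_le fun k => (hg k).trans ?_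
    exact le_mul_of_one_le_right' (by norm_num)
  · have hp1 : 1 ≤ p.toReal := by
      rw [← ENNReal.toReal_one]; exact ENNReal.toReal_mono hpt hp
    have hp0 : 0 < p.toReal := by linarith
    rw [tsum_eq_sum (s := Finset.Icc (a - 1) (a + 1))
      (fun t ht => by rw [hg0 t ht, ENNReal.zero_rpow_of_pos hp0])]
    have h1 : ∑ t ∈ Finset.Icc (a - 1) (a + 1), g t ^ p.toReal ≤ c ^ p.toReal * 3 := by
      refine (Finset.sum_le_card_nsmul _ _ (c ^ p.toReal)
        (fun t _ => ENNReal.rpow_le_rpow (hg t) hp0.le)).trans (le_of_eq ?_)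
      have : (a + 1 + 1 - (a - 1)).toNat = 3 := by 
        have : a + 1 + 1 - (a - 1) = 3 := by ring
        rw [this]; rfl
      rw [Int.card_Icc, this, nsmul_eq_mul, mul_comm]; norm_num
    calc _ ≤ (c ^ p.toReal * 3) ^ (1 / p.toReal) := ENNReal.rpow_le_rpow h1 (by positivity)
      _ = c * 3 ^ (1 / p.toReal) := by
        rw [ENNReal.mul_rpow_of_nonneg _ _ (by positivity), ← ENNReal.rpow_mul,
            mul_one_div_cancel hp0.ne', ENNReal.rpow_one]
      _ ≤ c * 3 := by
        gcongr
        calc (3 : ℝ≥0∞) ^ (1 / p.toReal) ≤ 3 ^ (1 : ℝ) := 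
              ENNReal.rpow_le_rpow_of_exponent_le (by norm_num) ((div_le_one hp0).2 hp1)
          _ = 3 := by simp

lemma mixedSeq_le (n : ℕ) : ∀ (s : Fin n → ℝ≥0∞), (∀ i, 1 ≤ s i) → ∀ (c : ℝ≥0∞),
    ∀ (a : Fin n → ℤ) (g : (Fin n → ℤ) → ℝ≥0∞), (∀ x, g x ≤ c) →
    (∀ x, (∃ i, x i ∉ Finset.Icc (a i - 1) (a i + 1)) → g x = 0) →
    mixedSeq n s g ≤ c * 3 ^ n := by
  induction n with
  | zero => 
    intro p _ c a g hg _
    simpa [mixedSeq] using hg _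
  | succ n ih =>
    intro p hp c a g hg hg0
    have key := lpSum_le (hp (Fin.last n)) (c := c * 3 ^ n) (a (Fin.last n)) 
      (fun t => mixedSeq n (fun i => p i.castSucc) fun x => g (Fin.snoc x t)) ?_ ?_
    · refine key.trans (le_of_eq ?_)
      rw [pow_succ, mul_assoc]
    · intro t
      refine ih _ (fun i => hp _) c (fun i => a i.castSucc) _ (fun x => hg _) ?_
      rintro x ⟨i, hi⟩
      exact hg0 _ ⟨i.castSucc, by simpa only [Fin.snoc_castSucc] using hi⟩
    · intro t ht
      have := ih (fun i => p i.castSucc) (fun i => hp _) 0 (fun i => a i.castSucc)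
        (fun x => g (Fin.snoc x t)) 
        (fun x => (hg0 _ ⟨Fin.last n, by simpa only [Fin.snoc_last] using ht⟩).le) 
        (fun x _ => hg0 _ ⟨Fin.last n, by simpa only [Fin.snoc_last] using ht⟩)
      simpa using this

lemma eball_abs {n : ℕ} {y x : Fin n → ℝ} {r : ℝ} (hx : x ∈ eball n y r) (i : Fin n) :
    |x i - y i| < r := by
  refine lt_of_le_of_lt ?_ hx
  rw [← Real.sqrt_sq_eq_abs]
  exact Real.sqrt_le_sqrt (Finset.single_le_sum (f := fun i => (x i - y i) ^ 2)
    (fun _ _ => sq_nonneg _) (Finset.mem_univ i))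

lemma isOpen_eball (n : ℕ) (y : Fin n → ℝ) (r : ℝ) : IsOpen (eball n y r) :=
  isOpen_lt (by fun_prop) continuous_const

lemma volume_eball_ge (n : ℕ) (hn : 1 ≤ n) (y : Fin n → ℝ) (r : ℝ) (hr : 0 < r) :
    ENNReal.ofReal ((2 * r / n) ^ n) ≤ volume (eball n y r) := by
  have hn' : (1 : ℝ) ≤ n := by exact_mod_cast hn
  have hrn : 0 < r / n := by positivity
  have : Metric.ball y (r / n) ⊆ eball n y r := by
    intro x hx
    rw [mem_ball_iff_norm, pi_norm_lt_iff hrn] at hx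
    have h2 : ∑ i, (x i - y i) ^ 2 < r ^ 2 := by
      calc ∑ i, (x i - y i) ^ 2 < ∑ _i : Fin n, (r / n) ^ 2 := by
            apply Finset.sum_lt_sum_of_nonempty
            · exact ⟨⟨0, hn⟩, Finset.mem_univ _⟩
            · intro i _
              exact sq_lt_sq' (neg_lt_of_abs_lt (hx i)) (lt_of_abs_lt (hx i))
        _ = r ^ 2 / n := by simp; field_simp
        _ ≤ r ^ 2 := div_le_self (by positivity) hn'
    exact (Real.sqrt_lt' hr).2 h2
  refine le_trans (le_of_eq ?_) (measure_mono this)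
  rw [Real.volume_pi_ball y hrn]
  simp [mul_div_assoc]

lemma part1 (n : ℕ) (hn : 1 ≤ n) (p s : Fin n → ℝ≥0∞) (a : ℝ)
    (hp : ∀ i, 1 ≤ p i) (hs : ∀ i, 1 ≤ s i) 
    (hα1 : invSum n s / (n : ℝ) ≤ a)
    (hα2 : a ≤ invSum n p / (n : ℝ)) (x₀ : Fin n → ℝ) (r₀ : ℝ) (hr₀ : 0 < r₀) (r : ℝ)
    (hr : 0 < r) :
    (mixedE n s fun y =>
      volume (eball n y r) ^ (a - invSum n p / (n : ℝ) - invSum n s / (n : ℝ)) *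
        mixedLp n p ((eball n y r).indicator ((eball n x₀ r₀).indicator fun _ => (1 : ℝ)))) ≤
    ENNReal.ofReal ((2 / n : ℝ) ^ (n * a - invSum n p - invSum n s) * 2 ^ invSum n p *
      4 ^ invSum n s) * ENNReal.ofReal (r₀ ^ ((n : ℝ) * a)) := by
  have hP := invSum_nonneg n p
  have hS := invSum_nonneg n s
  set P := invSum n p
  set S := invSum n s
  have hn' : (0 : ℝ) < n := by exact_mod_cast hn
  have hα1' : S ≤ n * a := by rw [div_le_iff₀ hn'] at hα1; linarith
  have hα2' : n * a ≤ P := by rw [le_div_iff₀ hn'] at hα2; linarith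
  set e := a - P / n - S / n with he
  have hne : n * e = n * a - P - S := by rw [he]; field_simp
  have he0 : e ≤ 0 := by
    have : n * e ≤ 0 := by rw [hne]; linarith
    by_contra hcon
    push Not at hcon
    have := mul_pos hn' hcon
    linarith
  have hm : 0 < min r r₀ := lt_min hr hr₀
  have hV : ∀ y, volume (eball n y r) ^ e ≤ ENNReal.ofReal ((2 / n : ℝ) ^ (n * a - P - S) *
      r ^ (n * a - P - S)) := by
    intro y
    calc volume (eball n y r) ^ e ≤ ENNReal.ofReal ((2 * r / n) ^ n) ^ e := by
          have h := ENNReal.inv_le_inv.2 (ENNReal.rpow_le_rpow (volume_eball_ge n hn y r hr)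
            (neg_nonneg.2 he0))
          simpa only [ENNReal.rpow_neg, inv_inv] using h
      _ = _ := by
          rw [ENNReal.ofReal_rpow_of_pos (by positivity), ← Real.rpow_natCast,
            ← Real.rpow_mul (by positivity), hne, ← Real.mul_rpow (by positivity) hr.le]
          congr 3; ring
  have hin : ∀ y, mixedLp n p ((eball n y r).indicator
      ((eball n x₀ r₀).indicator fun _ => (1 : ℝ))) ≤ ENNReal.ofReal ((2 * min r r₀) ^ P) := by
    intro y
    have h1 : ∀ x, (‖(eball n y r).indicator
      ((eball n x₀ r₀).indicator fun _ => (1 : ℝ)) x‖₊ : ℝ≥0∞) ≤ 1 := by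
      intro x
      by_cases hx : x ∈ eball n y r <;> by_cases hx' : x ∈ eball n x₀ r₀ <;> simp [hx, hx']
    rw [← ENNReal.ofReal_rpow_of_pos (by positivity)]
    rcases le_total r r₀ with hle | hle
    · rw [min_eq_left hle]
      refine (mixedE_le n p hp 1 (by simp) y r _ h1 ?_).trans (by simp [P])
      rintro x ⟨i, hi⟩
      have : x ∉ eball n y r := fun hx => (eball_abs hx i).not_ge hi.le
      simp [this]
    · rw [min_eq_right hle]
      refine (mixedE_le n p hp 1 (by simp) x₀ r₀ _ h1 ?_).trans (by simp [P])
      rintro x ⟨i, hi⟩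
      have : x ∉ eball n x₀ r₀ := fun hx => (eball_abs hx i).not_ge hi.le
      by_cases hx : x ∈ eball n y r <;> simp [this, hx]
  have hout := mixedE_le n s hs (ENNReal.ofReal ((2 / n : ℝ) ^ (n * a - P - S) *
      r ^ (n * a - P - S)) * ENNReal.ofReal ((2 * min r r₀) ^ P)) 
      (ENNReal.mul_ne_top ENNReal.ofReal_ne_top ENNReal.ofReal_ne_top) x₀ (r + r₀)
      (fun y => volume (eball n y r) ^ e * mixedLp n p ((eball n y r).indicator
      ((eball n x₀ r₀).indicator fun _ => (1 : ℝ)))) (fun y => mul_le_mul' (hV y) (hin y)) ?_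
  · refine hout.trans ?_
    rw [ENNReal.ofReal_rpow_of_pos (by positivity), ← ENNReal.ofReal_mul (by positivity),
      ← ENNReal.ofReal_mul (by positivity), ← ENNReal.ofReal_mul (by positivity)]
    apply ENNReal.ofReal_le_ofReal
    have h4 : (2 * (r + r₀)) ^ S ≤ 4 ^ S * (max r r₀) ^ S := by
      rw [← Real.mul_rpow (by norm_num) (by positivity)]
      apply Real.rpow_le_rpow (by positivity) _ hS
      linarith [le_max_left r r₀, le_max_right r r₀]
    have h5 : r ^ (n * a - P - S) * (min r r₀) ^ P * (max r r₀) ^ S ≤ r₀ ^ (n * a) := by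
      rcases le_total r r₀ with hle | hle
      · rw [min_eq_left hle, max_eq_right hle, ← Real.rpow_add hr]
        calc r ^ (n * a - P - S + P) * r₀ ^ S ≤ r₀ ^ (n * a - P - S + P) * r₀ ^ S := by
              gcongr
              linarith
          _ = _ := by rw [← Real.rpow_add hr₀]; congr 1; ring
      · rw [min_eq_right hle, max_eq_left hle, mul_right_comm, ← Real.rpow_add hr]
        calc r ^ (n * a - P - S + S) * r₀ ^ P ≤ r₀ ^ (n * a - P - S + S) * r₀ ^ P := by
              gcongr ?_ * _
              exact Real.rpow_le_rpow_of_nonpos hr₀ hle (by linarith)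
          _ = _ := by rw [← Real.rpow_add hr₀]; congr 1; ring
    rw [Real.mul_rpow (by norm_num : (0:ℝ) ≤ 2) hm.le]
    calc _ ≤ (2 / n : ℝ) ^ (n * a - P - S) * r ^ (n * a - P - S) * (2 ^ P * min r r₀ ^ P) *
          (4 ^ S * (max r r₀) ^ S) := by
            apply mul_le_mul_of_nonneg_left h4 (by positivity)
      _ = (2 / n : ℝ) ^ (n * a - P - S) * 2 ^ P * 4 ^ S * 
          (r ^ (n * a - P - S) * (min r r₀) ^ P * (max r r₀) ^ S) := by ring
      _ ≤ _ := by 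
            apply mul_le_mul_of_nonneg_left h5 (by positivity)
  · rintro y ⟨i, hi⟩
    have hz : ∀ x, (eball n y r).indicator
      ((eball n x₀ r₀).indicator fun _ => (1 : ℝ)) x = 0 := by
      intro x
      by_cases hx : x ∈ eball n y r
      · by_cases hx' : x ∈ eball n x₀ r₀
        · exfalso
          have h1 := eball_abs hx i
          have h2 := eball_abs hx' i
          have h3 := abs_sub_le (y i) (x i) (x₀ i)
          rw [abs_sub_comm (y i) (x i)] at h3
          linarith
        · simp [hx, hx']
      · simp [hx]
    have : mixedLp n p ((eball n y r).indicator
      ((eball n x₀ r₀).indicator fun _ => (1 : ℝ))) ≤ _ := 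
      mixedE_le n p hp 0 (by simp) 0 0 _ (fun x => by simp [hz x]) (fun x _ => by simp [hz x])
    simp only [zero_mul, nonpos_iff_eq_zero] at this
    simp only [this, mul_zero]

lemma one_le_conj {p p' : ℝ≥0∞} (h : 1 / p + 1 / p' = 1) : 1 ≤ p' := by
  have : 1 / p' ≤ 1 := le_add_self.trans h.le
  simpa using this

lemma part2 (n : ℕ) (p' s' : Fin n → ℝ≥0∞) (α' : ℝ≥0∞)
    (hp : ∀ i, 1 ≤ p' i) (hs : ∀ i, 1 ≤ s' i) (x₀ : Fin n → ℝ) (r₀ : ℝ) (hr₀ : 0 < r₀) :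
    hNorm n p' s' α' ((eball n x₀ r₀).indicator fun _ => (1 : ℝ)) ≤
          ENNReal.ofReal (3 ^ n) * ENNReal.ofReal (r₀ ^ ((n : ℝ) * (1 / α').toReal)) := by
  set b := (n : ℝ) * (1 / α').toReal with hb
  set z : Fin n → ℝ := r₀⁻¹ • x₀ with hz
  have hsup : (Function.support fun j : ℕ => |if j = 0 then (3 : ℝ) ^ n * r₀ ^ b else 0|) ⊆ 
      (({0} : Finset ℕ) : Set ℕ) := by
    intro j hj
    by_contra h
    simp at h
    simp [h] at hj
  have hball : ∀ x, r₀⁻¹ • x ∈ eball n z 1 ↔ x ∈ eball n x₀ r₀ := by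
    intro x
    simp only [eball, mem_setOf_eq, hz, Pi.smul_apply, smul_eq_mul]
    have : ∑ i, (r₀⁻¹ * x i - r₀⁻¹ * x₀ i) ^ 2 = r₀⁻¹ ^ 2 * ∑ i, (x i - x₀ i) ^ 2 := by
      rw [Finset.mul_sum]; congr 1; ext i; ring
    rw [this, Real.sqrt_mul (by positivity), Real.sqrt_sq (by positivity), inv_mul_lt_iff₀ hr₀,
      mul_one]
  have hdec : BlockDecomp n p' s' α' ((eball n x₀ r₀).indicator fun _ => (1 : ℝ))
      (fun j => if j = 0 then 3 ^ n * r₀ ^ b else 0) (fun _ => r₀)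
      (fun _ => (eball n z 1).indicator fun _ => ((3 : ℝ) ^ n)⁻¹) := by
    refine ⟨summable_of_finite_support ((Finset.finite_toSet _).subset hsup), fun _ => hr₀,
      fun _ => (locallyIntegrable_const _).indicator (isOpen_eball n z 1).measurableSet, 
      fun _ => ?_, fun K _ => ?_⟩
    · have hle := mixedSeq_le n s' hs (ENNReal.ofReal ((3 : ℝ) ^ n)⁻¹) (fun i => ⌊z i⌋)
        (fun k => mixedLp n p' ((qcube n 1 k).indicator ((eball n z 1).indicator 
          fun _ => ((3 : ℝ) ^ n)⁻¹))) ?_ ?_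
      · refine hle.trans ?_
        have : (3 : ℝ≥0∞) ^ n = ENNReal.ofReal (3 ^ n) := by
          rw [ENNReal.ofReal_pow (by norm_num)]; norm_num
        rw [this, ← ENNReal.ofReal_mul (by positivity), inv_mul_cancel₀ (by positivity)]
        simp
      · intro k
        refine (mixedE_le n p' hp (ENNReal.ofReal ((3 : ℝ) ^ n)⁻¹) ENNReal.ofReal_ne_top 
          (fun i => k i + 1 / 2) (1 / 2) _ ?_ ?_).trans (by simp)
        · intro x
          rw [← enorm_eq_nnnorm, ← Real.enorm_of_nonneg (by positivity)]
          exact (enorm_indicator_le_enorm_self _ _).trans (enorm_indicator_le_enorm_self _ _)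
        · rintro x ⟨i, hi⟩
          have : x ∉ qcube n 1 k := by
            intro hx
            have := hx i
            rw [lt_abs] at hi
            rcases hi with hi | hi <;> linarith
          simp [this]
      · rintro k ⟨i, hi⟩
        have hz : ∀ x, (qcube n 1 k).indicator ((eball n z 1).indicator 
          fun _ => ((3 : ℝ) ^ n)⁻¹) x = 0 := by
          intro x
          by_cases hx : x ∈ qcube n 1 k
          · by_cases hx' : x ∈ eball n z 1
            · exfalso
              apply hi
              have h1 := abs_lt.1 (eball_abs hx' i)
              have h2 := hx i
              have h3 := Int.floor_le (z i)
              have h4 := Int.lt_floor_add_one (z i)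
              rw [Finset.mem_Icc]
              constructor
              · have : ((⌊z i⌋ : ℤ) : ℝ) < k i + 2 := by linarith
                have : ⌊z i⌋ < k i + 2 := by exact_mod_cast this
                omega
              · have : ((k i : ℤ) : ℝ) < ⌊z i⌋ + 2 := by linarith
                have : k i < ⌊z i⌋ + 2 := by exact_mod_cast this
                omega
            · simp [hx, hx']
          · simp [hx]
        have := mixedE_le n p' hp 0 (by simp) 0 0 
          (fun x => (‖(qcube n 1 k).indicator ((eball n z 1).indicator 
          fun _ => ((3 : ℝ) ^ n)⁻¹) x‖₊ : ℝ≥0∞)) 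
          (fun x => by simp [hz x]) (fun x _ => by simp [hz x])
        rw [zero_mul, nonpos_iff_eq_zero] at this
        exact this
    · apply tendsto_const_nhds.congr'
      filter_upwards [eventually_ge_atTop 1] with J hJ
      have hsum : ∀ x, ∑ j ∈ Finset.range J, (if j = 0 then 3 ^ n * r₀ ^ b else 0) *
          dil n α' r₀ ((eball n z 1).indicator fun _ => ((3 : ℝ) ^ n)⁻¹) x =
          (eball n x₀ r₀).indicator (fun _ => (1 : ℝ)) x := by
        intro x
        rw [Finset.sum_eq_single_of_mem 0 (Finset.mem_range.2 hJ) 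
          (fun j _ hj => by simp [hj])]
        simp only [if_true, dil, ← hb]
        by_cases hx : x ∈ eball n x₀ r₀
        · rw [indicator_of_mem hx, indicator_of_mem ((hball x).2 hx), Real.rpow_neg hr₀.le]
          have := Real.rpow_pos_of_pos hr₀ b
          field_simp
        · rw [indicator_of_notMem hx, indicator_of_notMem (fun h => hx ((hball x).1 h))]
          simp
      simp only [hsum, sub_self, nnnorm_zero, ENNReal.coe_zero, lintegral_zero]
  unfold hNorm
  refine iInf_le_of_le _ (iInf_le_of_le _ (iInf_le_of_le _ (iInf_le_of_le hdec ?_)))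
  rw [tsum_eq_sum' hsup, Finset.sum_singleton, if_pos rfl, abs_of_nonneg (by positivity),
    ENNReal.ofReal_mul (by positivity)]

/-- Norm estimates of the characteristic function of a ball in
`(L^{p⃗},L^{s⃗})^α(ℝⁿ)` and in the block space `H(p⃗',s⃗',α')`. -/
theorem statement19 (n : ℕ) (hn : 1 ≤ n) (p s p' s' : Fin n → ℝ≥0∞) (α α' : ℝ≥0∞)
    (hp : ∀ i, 1 ≤ p i) (hs : ∀ i, 1 ≤ s i) (hα : 1 ≤ α)
    (h0 : 0 ≤ invSum n s / (n : ℝ))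
    (hα1 : invSum n s / (n : ℝ) ≤ (1 / α).toReal)
    (hα2 : (1 / α).toReal ≤ invSum n p / (n : ℝ))
    (hα3 : invSum n p / (n : ℝ) < 1)
    (hp' : ∀ i, 1 / p i + 1 / p' i = 1) (hs' : ∀ i, 1 / s i + 1 / s' i = 1)
    (hαα' : 1 / α + 1 / α' = 1) :
    ∃ C : ℝ≥0∞, 0 < C ∧ C < ∞ ∧
      ∀ (x₀ : Fin n → ℝ) (r₀ : ℝ), 0 < r₀ →
        amalgamNormA n p s α ((eball n x₀ r₀).indicator fun _ => (1 : ℝ)) ≤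
          C * ENNReal.ofReal (r₀ ^ ((n : ℝ) * (1 / α).toReal)) ∧
        hNorm n p' s' α' ((eball n x₀ r₀).indicator fun _ => (1 : ℝ)) ≤
          C * ENNReal.ofReal (r₀ ^ ((n : ℝ) * (1 / α').toReal)) := by
  refine ⟨ENNReal.ofReal ((2 / n : ℝ) ^ (n * (1 / α).toReal - invSum n p - invSum n s) *
    2 ^ invSum n p * 4 ^ invSum n s) + ENNReal.ofReal (3 ^ n), ?_, ?_, ?_⟩
  · exact lt_of_lt_of_le (ENNReal.ofReal_pos.2 (by positivity)) le_add_self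
  · exact ENNReal.add_lt_top.2 ⟨ENNReal.ofReal_lt_top, ENNReal.ofReal_lt_top⟩
  · intro x₀ r₀ hr₀
    constructor
    · refine iSup₂_le fun r hr => ?_
      refine (part1 n hn p s _ hp hs hα1 hα2 x₀ r₀ hr₀ r hr).trans ?_
      gcongr
      exact le_self_add
    · refine (part2 n p' s' α' (fun i => one_le_conj (hp' i)) (fun i => one_le_conj (hs' i)) 
        x₀ r₀ hr₀).trans ?_
      gcongr
      exact le_add_self

end MixedAmalgam

end
end
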